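/- arXiv:1509.07098 — 2 statements merged into one kernel-verified Lean document; each statement's English description precedes it below -/
import Mathlib

section
/- The only pairs (u,w) ∈ ℚ × ℚ satisfying w² = −u(u⁶ − 4u⁵ − 3u⁴ − 8u³ + 3u² − 4u − 1) are (0,0), (1,4), (1,−4), (−1,4), and (−1,−4). -/
/-- `σ` is a root of `X³ + 2X² + 2` generating a prime with residue field of two elements, and
every unit is a square up to a sign and a power of the unit `σ² + 1`. -/
structure IsDescentRoot {R : Type*} [CommRing R] (σ : R) : Prop where
  root : σ ^ 3 + 2 * σ ^ 2 + 2 = 0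
  prime : Prime σ
  residue : ∀ x : R, σ ∣ x ∨ σ ∣ x - 1
  units : ∀ e : Rˣ, ∃ v : Rˣ, (e : R) = v ^ 2 ∨ (e : R) = -v ^ 2 ∨
    (e : R) = (σ ^ 2 + 1) * v ^ 2 ∨ (e : R) = -((σ ^ 2 + 1) * v ^ 2)

namespace IsDescentRoot

variable {R : Type*} [CommRing R] {σ : R}

/-- The unit `σ² + 1`. -/
def eta (h : IsDescentRoot σ) : Rˣ where
  val := σ ^ 2 + 1
  inv := 1 - 2 * σ - σ ^ 2
  val_inv := by linear_combination (-σ) * h.root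
  inv_val := by linear_combination (-σ) * h.root

lemma coe_eta (h : IsDescentRoot σ) : (h.eta : R) = σ ^ 2 + 1 := rfl

lemma pow_three_eq (h : IsDescentRoot σ) : σ ^ 3 = -2 * (σ ^ 2 + 1) := by
  linear_combination h.root

lemma two_eq (h : IsDescentRoot σ) : (2 : R) = σ ^ 3 * (σ ^ 2 + 2 * σ - 1) := by
  linear_combination (1 - σ ^ 2) * h.root

lemma pow_three_dvd_two (h : IsDescentRoot σ) : σ ^ 3 ∣ 2 := ⟨_, h.two_eq⟩

lemma two_dvd_pow_three (h : IsDescentRoot σ) : 2 ∣ σ ^ 3 :=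
  ⟨-(σ ^ 2 + 1), by linear_combination h.root⟩

lemma dvd_two (h : IsDescentRoot σ) : σ ∣ 2 :=
  (dvd_pow_self σ three_ne_zero).trans h.pow_three_dvd_two

lemma dvd_two_mul (h : IsDescentRoot σ) (x : R) : σ ∣ 2 * x := h.dvd_two.mul_right x

lemma not_dvd_unit (h : IsDescentRoot σ) (e : Rˣ) : ¬ σ ∣ e := fun hd =>
  h.prime.not_isUnit (isUnit_of_dvd_unit hd e.isUnit)

lemma not_dvd_one (h : IsDescentRoot σ) : ¬ σ ∣ 1 := h.prime.not_dvd_one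

lemma dvd_sub_one (h : IsDescentRoot σ) {x : R} (hx : ¬ σ ∣ x) : σ ∣ x - 1 :=
  (h.residue x).resolve_left hx

lemma dvd_sub_of_not_dvd (h : IsDescentRoot σ) {x y : R} (hx : ¬ σ ∣ x) (hy : ¬ σ ∣ y) :
    σ ∣ x - y := by
  simpa using dvd_sub (h.dvd_sub_one hx) (h.dvd_sub_one hy)

lemma not_dvd_mul (h : IsDescentRoot σ) {x y : R} (hx : ¬ σ ∣ x) (hy : ¬ σ ∣ y) :
    ¬ σ ∣ x * y := fun hd => (h.prime.dvd_or_dvd hd).elim hx hy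

lemma not_dvd_pow (h : IsDescentRoot σ) {x : R} (hx : ¬ σ ∣ x) (n : ℕ) : ¬ σ ∣ x ^ n :=
  fun hd => hx (h.prime.dvd_of_dvd_pow hd)

lemma dvd_intCast_iff (h : IsDescentRoot σ) (n : ℤ) : σ ∣ (n : R) ↔ 2 ∣ n := by
  constructor
  · intro hd
    by_contra hn
    obtain ⟨k, hk⟩ : ∃ k, n = 2 * k + 1 := ⟨n / 2, by omega⟩
    apply h.not_dvd_one
    have := dvd_sub hd (h.dvd_two_mul (k : R))
    rw [hk] at this
    push_cast at this
    simpa using this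
  · rintro ⟨k, rfl⟩
    push_cast
    exact h.dvd_two_mul _

lemma two_dvd_coords [IsDomain R] (h : IsDescentRoot σ) {p q r : ℤ}
    (hd : (2 : R) ∣ p + q * σ + r * σ ^ 2) : 2 ∣ p ∧ 2 ∣ q ∧ 2 ∣ r := by
  have h3 := h.pow_three_dvd_two.trans hd
  have hp : (2 : ℤ) ∣ p := by
    rw [← h.dvd_intCast_iff]
    have := dvd_sub ((dvd_pow_self σ three_ne_zero).trans h3)
      (Dvd.intro (q + r * σ : R) rfl)
    ring_nf at this
    exact this
  have h3' : σ ^ 3 ∣ σ * (q + r * σ) := by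
    have hp' : (2 : R) ∣ p := by simpa using (Int.castRingHom R).map_dvd hp
    have := dvd_sub h3 (h.pow_three_dvd_two.trans hp')
    ring_nf at this ⊢
    exact this
  have h2 : σ ^ 2 ∣ (q + r * σ : R) := by
    rw [pow_succ'] at h3'
    exact (mul_dvd_mul_iff_left h.prime.ne_zero).1 h3'
  have hq : (2 : ℤ) ∣ q := by
    rw [← h.dvd_intCast_iff]
    have := dvd_sub ((dvd_pow_self σ two_ne_zero).trans h2) (Dvd.intro_left (r : R) rfl)
    simpa using this
  have h2' : σ ^ 2 ∣ σ * r := by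
    have hq' : (2 : R) ∣ q := by simpa using (Int.castRingHom R).map_dvd hq
    have := dvd_sub h2
      (((pow_dvd_pow σ (by norm_num : 2 ≤ 3)).trans h.pow_three_dvd_two).trans hq')
    ring_nf at this ⊢
    exact this
  refine ⟨hp, hq, ?_⟩
  rw [← h.dvd_intCast_iff]
  rw [pow_two] at h2'
  exact (mul_dvd_mul_iff_left h.prime.ne_zero).1 h2'

lemma two_ne_zero' [IsDomain R] (h : IsDescentRoot σ) : (2 : R) ≠ 0 := by
  intro h0
  have := h.pow_three_eq
  rw [h0] at this
  exact h.prime.ne_zero (pow_eq_zero_iff (three_ne_zero)|>.1 (by simpa using this))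

lemma four_ne_zero' [IsDomain R] (h : IsDescentRoot σ) : (4 : R) ≠ 0 := by
  rw [show (4 : R) = 2 * 2 by norm_num]
  exact mul_ne_zero h.two_ne_zero' h.two_ne_zero'

lemma four_dvd_coords [IsDomain R] (h : IsDescentRoot σ) {p q r : ℤ}
    (hd : (4 : R) ∣ p + q * σ + r * σ ^ 2) : 4 ∣ p ∧ 4 ∣ q ∧ 4 ∣ r := by
  have e4 : (4 : R) = 2 * 2 := by norm_num
  obtain ⟨⟨p, rfl⟩, ⟨q, rfl⟩, ⟨r, rfl⟩⟩ :=
    h.two_dvd_coords ((Dvd.intro _ e4.symm).trans hd)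
  have : (2 : R) ∣ p + q * σ + r * σ ^ 2 := by
    rw [e4] at hd
    rw [← mul_dvd_mul_iff_left h.two_ne_zero']
    refine hd.trans (dvd_of_eq ?_)
    push_cast
    ring
  obtain ⟨⟨p, rfl⟩, ⟨q, rfl⟩, ⟨r, rfl⟩⟩ := h.two_dvd_coords this
  refine ⟨⟨p, by ring⟩, ⟨q, by ring⟩, ⟨r, by ring⟩⟩

lemma exists_bit (h : IsDescentRoot σ) (x : R) : ∃ (p : ℤ) (y : R), x = p + σ * y := by
  rcases h.residue x with ⟨y, hy⟩ | ⟨y, hy⟩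
  · exact ⟨0, y, by simpa using hy⟩
  · exact ⟨1, y, by push_cast; linear_combination hy⟩

lemma exists_coords_two (h : IsDescentRoot σ) (x : R) :
    ∃ (p q r : ℤ) (y : R), x = p + q * σ + r * σ ^ 2 + 2 * y := by
  obtain ⟨p, x₁, rfl⟩ := h.exists_bit x
  obtain ⟨q, x₂, rfl⟩ := h.exists_bit x₁
  obtain ⟨r, x₃, rfl⟩ := h.exists_bit x₂
  exact ⟨p, q, r, -(σ ^ 2 + 1) * x₃, by linear_combination x₃ * h.root⟩

lemma exists_coords_four (h : IsDescentRoot σ) (x : R) :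
    ∃ (p q r : ℤ) (y : R), x = p + q * σ + r * σ ^ 2 + 4 * y := by
  obtain ⟨p, q, r, x, rfl⟩ := h.exists_coords_two x
  obtain ⟨p', q', r', x, rfl⟩ := h.exists_coords_two x
  exact ⟨p + 2 * p', q + 2 * q', r + 2 * r', x, by push_cast; ring⟩

/-- Squares of elements prime to `σ`, modulo `4`. -/
lemma exists_sq_eq (h : IsDescentRoot σ) {x : R} (hx : ¬ σ ∣ x) :
    ∃ (q r : ℤ) (y : R),
      x ^ 2 = 1 + (2 * (q + r) : ℤ) * σ + (q ^ 2 + 2 * r : ℤ) * σ ^ 2 + 4 * y := by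
  obtain ⟨p, q, r, y, rfl⟩ := h.exists_coords_four x
  have hp : ¬ (2 ∣ p) := by
    rintro ⟨k, rfl⟩
    apply hx
    obtain ⟨t, ht⟩ := h.dvd_two
    refine ⟨t * k + q + r * σ + 2 * t * y, ?_⟩
    push_cast
    linear_combination (k + 2 * y : R) * ht
  obtain ⟨k, rfl⟩ : ∃ k, p = 2 * k + 1 := ⟨p / 2, by omega⟩
  obtain ⟨c, hc⟩ := Int.even_mul_succ_self r
  refine ⟨q, r, ?_⟩
  have hc' : (r : R) ^ 2 = 2 * c - r := by
    have : (r ^ 2 : ℤ) = 2 * c - r := by linear_combination hc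
    exact_mod_cast congrArg (Int.cast : ℤ → R) this
  refine ⟨k ^ 2 + k + k * q * σ + k * r * σ ^ 2 - q * r * (1 + σ ^ 2) + r ^ 2 * (1 + σ ^ 2)
    - c * σ + 4 * y ^ 2 + 2 * y * (2 * k + 1 + q * σ + r * σ ^ 2), ?_⟩
  push_cast
  linear_combination (2 * q * r + r ^ 2 * (σ - 2) : R) * h.root - 2 * σ * hc'

lemma sq_dvd_sq_sub_one (h : IsDescentRoot σ) {x : R} (hx : ¬ σ ∣ x) : σ ^ 2 ∣ x ^ 2 - 1 := by
  obtain ⟨y, hy⟩ := h.dvd_sub_one hx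
  obtain ⟨t, ht⟩ := h.dvd_two
  exact ⟨t * y + y ^ 2, by linear_combination (x + 1) * hy + σ * y * (hy + ht)⟩

lemma sq_dvd_unit_sub_one (h : IsDescentRoot σ) (e : Rˣ) : σ ^ 2 ∣ (e : R) - 1 := by
  obtain ⟨v, hv⟩ := h.units e
  obtain ⟨y, hy⟩ := h.sq_dvd_sq_sub_one (h.not_dvd_unit v)
  have h2 := h.two_eq
  set t := σ * (σ ^ 2 + 2 * σ - 1)
  rcases hv with hv | hv | hv | hv
  · exact ⟨y, by linear_combination hv + hy⟩
  · exact ⟨-y - t, by linear_combination hv - hy - h2⟩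
  · exact ⟨v ^ 2 + y, by linear_combination hv + hy⟩
  · exact ⟨-v ^ 2 - y - t, by linear_combination hv - hy - h2⟩

lemma two_pow_eq (h : IsDescentRoot σ) (k : ℕ) : ∃ e : Rˣ, (2 : R) ^ k = σ ^ (3 * k) * e := by
  refine ⟨(-h.eta⁻¹) ^ k, ?_⟩
  rw [h.two_eq, mul_pow, pow_mul]
  push_cast
  change _ = (σ ^ 3) ^ k * (-(1 - 2 * σ - σ ^ 2)) ^ k
  ring

/-- Translation by a point relates the twisted quartic to the quartic with `u = σ² + 1`. -/
lemma translate_eq (h : IsDescentRoot σ) {a b γ : R}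
    (hγ : γ ^ 2 = (σ ^ 2 + 1) * (b ^ 4 - 2 * σ * a ^ 2 * b ^ 2 - a ^ 4)) :
    (σ ^ 2 * (σ ^ 2 + 1) * (a ^ 2 + b ^ 2) * γ
        + 2 * (σ ^ 2 + 1) ^ 2 * a * b * ((b ^ 2 - a ^ 2) - σ * (a ^ 2 + b ^ 2))) ^ 2 =
      (σ ^ 2 + 1) ^ 2 * (σ ^ 2 * a * b + γ) ^ 4
        - 2 * σ * (σ ^ 2 + 1) * ((σ ^ 2 + 1) * (b ^ 2 - a ^ 2)) ^ 2 * (σ ^ 2 * a * b + γ) ^ 2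
        - ((σ ^ 2 + 1) * (b ^ 2 - a ^ 2)) ^ 4 := by
  have := h.root
  grind

end IsDescentRoot

namespace IsDescentRoot

variable {R : Type*} [CommRing R] [IsDomain R] {σ : R}

/-- A congruence modulo `4` between integral combinations of `1, σ, σ²`, read off in `ZMod 4`. -/
lemma zmod_coords (h : IsDescentRoot σ) {p q r : ℤ} {y : R}
    (hd : (p + q * σ + r * σ ^ 2 : R) = 4 * y) :
    (p : ZMod 4) = 0 ∧ (q : ZMod 4) = 0 ∧ (r : ZMod 4) = 0 := by
  obtain ⟨hp, hq, hr⟩ := h.four_dvd_coords ⟨y, hd⟩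
  exact ⟨(ZMod.intCast_zmod_eq_zero_iff_dvd p 4).2 (by exact_mod_cast hp),
    (ZMod.intCast_zmod_eq_zero_iff_dvd q 4).2 (by exact_mod_cast hq),
    (ZMod.intCast_zmod_eq_zero_iff_dvd r 4).2 (by exact_mod_cast hr)⟩

lemma not_neg_sq (h : IsDescentRoot σ) {x y : R} (hx : ¬ σ ∣ x) (hy : ¬ σ ∣ y) (t : ℤ) :
    ¬ 4 ∣ -x ^ 2 + 2 * t * σ - y ^ 2 := by
  rintro ⟨z, hz⟩
  obtain ⟨q, r, m, hm⟩ := h.exists_sq_eq hx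
  obtain ⟨q', r', n, hn⟩ := h.exists_sq_eq hy
  have := (h.zmod_coords (p := -2) (q := 2 * t - 2 * (q + r) - 2 * (q' + r'))
    (r := -(q ^ 2 + 2 * r) - (q' ^ 2 + 2 * r')) (y := z + m + n) (by
      push_cast at hm hn ⊢; linear_combination hz + hm + hn)).1
  revert this
  decide

lemma not_neg_eta_sq (h : IsDescentRoot σ) {x y : R} (hx : ¬ σ ∣ x) (hy : ¬ σ ∣ y) (t : ℤ) :
    ¬ 4 ∣ -((σ ^ 2 + 1) * x ^ 2) + 2 * t * σ - y ^ 2 := by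
  rintro ⟨z, hz⟩
  obtain ⟨q, r, m, hm⟩ := h.exists_sq_eq hx
  obtain ⟨q', r', n, hn⟩ := h.exists_sq_eq hy
  have := (h.zmod_coords (p := -2 + 4 * (q + r) - 4 * (q ^ 2 + 2 * r))
    (q := 2 * t - (2 * (q + r) - 2 * (q ^ 2 + 2 * r)) - 2 * (q' + r'))
    (r := -(5 * (q ^ 2 + 2 * r) + 1 - 4 * (q + r)) - (q' ^ 2 + 2 * r'))
    (y := z + (σ ^ 2 + 1) * m + n) (by
      push_cast at hm hn ⊢
      linear_combination hz + (σ ^ 2 + 1) * hm + hn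
        + (2 * (q + r) + (q ^ 2 + 2 * r) * (σ - 2) : R) * h.root)).1
  push_cast at this
  generalize (q : ZMod 4) = q, (r : ZMod 4) = r at this
  revert q r
  decide

lemma not_eta_sq (h : IsDescentRoot σ) {x y : R} (hx : ¬ σ ∣ x) (hy : ¬ σ ∣ y) :
    ¬ 4 ∣ (σ ^ 2 + 1) * x ^ 2 - y ^ 2 := by
  rintro ⟨z, hz⟩
  obtain ⟨q, r, m, hm⟩ := h.exists_sq_eq hx
  obtain ⟨q', r', n, hn⟩ := h.exists_sq_eq hy
  obtain ⟨-, h₁, h₂⟩ := h.zmod_coords (p := - 4 * (q + r) + 4 * (q ^ 2 + 2 * r))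
    (q := (2 * (q + r) - 2 * (q ^ 2 + 2 * r)) - 2 * (q' + r'))
    (r := (5 * (q ^ 2 + 2 * r) + 1 - 4 * (q + r)) - (q' ^ 2 + 2 * r'))
    (y := z - (σ ^ 2 + 1) * m + n) (by
      push_cast at hm hn ⊢
      linear_combination hz - (σ ^ 2 + 1) * hm + hn
        - (2 * (q + r) + (q ^ 2 + 2 * r) * (σ - 2) : R) * h.root)
  push_cast at h₁ h₂
  generalize (q : ZMod 4) = q, (r : ZMod 4) = r, (q' : ZMod 4) = q',
    (r' : ZMod 4) = r' at h₁ h₂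
  revert q r q' r'
  decide

lemma not_sq_add (h : IsDescentRoot σ) {x y : R} (hx : ¬ σ ∣ x) (hy : ¬ σ ∣ y) :
    ¬ 4 ∣ x ^ 2 + 2 * σ - y ^ 2 := by
  rintro ⟨z, hz⟩
  obtain ⟨q, r, m, hm⟩ := h.exists_sq_eq hx
  obtain ⟨q', r', n, hn⟩ := h.exists_sq_eq hy
  obtain ⟨-, h₁, h₂⟩ := h.zmod_coords (p := 0)
    (q := 2 + 2 * (q + r) - 2 * (q' + r'))
    (r := (q ^ 2 + 2 * r) - (q' ^ 2 + 2 * r'))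
    (y := z - m + n) (by push_cast at hm hn ⊢; linear_combination hz - hm + hn)
  push_cast at h₁ h₂
  generalize (q : ZMod 4) = q, (r : ZMod 4) = r, (q' : ZMod 4) = q',
    (r' : ZMod 4) = r' at h₁ h₂
  revert q r q' r'
  decide

/-- A unit that is a quotient of squares modulo `4` is a square. -/
lemma unit_eq_sq (h : IsDescentRoot σ) {e : Rˣ} {x y : R} (hx : ¬ σ ∣ x) (hy : ¬ σ ∣ y)
    (hd : 4 ∣ e * x ^ 2 - y ^ 2) : ∃ v : Rˣ, e = v ^ 2 := by
  obtain ⟨v, hv⟩ := h.units e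
  have hvx := h.not_dvd_mul (h.not_dvd_unit v) hx
  rcases hv with hv | hv | hv | hv
  · exact ⟨v, by ext; simpa using hv⟩
  · refine (h.not_neg_sq hvx hy 0 ?_).elim
    rw [hv] at hd
    convert hd using 1
    push_cast
    ring
  · refine (h.not_eta_sq hvx hy ?_).elim
    rw [hv] at hd
    convert hd using 1
    ring
  · refine (h.not_neg_eta_sq hvx hy 0 ?_).elim
    rw [hv] at hd
    convert hd using 1
    push_cast
    ring

lemma unit_eq_eta_sq (h : IsDescentRoot σ) {e : Rˣ} {x y : R} (hx : ¬ σ ∣ x) (hy : ¬ σ ∣ y)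
    (hd : 4 ∣ e * x ^ 2 + 2 * σ - y ^ 2) : ∃ v : Rˣ, e = h.eta * v ^ 2 := by
  obtain ⟨v, hv⟩ := h.units e
  have hvx := h.not_dvd_mul (h.not_dvd_unit v) hx
  rcases hv with hv | hv | hv | hv
  · refine (h.not_sq_add hvx hy ?_).elim
    rw [hv] at hd
    convert hd using 1
    ring
  · refine (h.not_neg_sq hvx hy 1 ?_).elim
    rw [hv] at hd
    convert hd using 1
    push_cast
    ring
  · exact ⟨v, by ext; simpa [coe_eta] using hv⟩
  · refine (h.not_neg_eta_sq hvx hy 1 ?_).elim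
    rw [hv] at hd
    convert hd using 1
    push_cast
    ring

lemma pow_dvd_of_dvd_mul (h : IsDescentRoot σ) {x y : R} (hx : ¬ σ ∣ x) {n : ℕ}
    (hd : σ ^ n ∣ x * y) : σ ^ n ∣ y :=
  h.prime.pow_dvd_of_dvd_mul_left n hx hd

lemma two_dvd_of_dvd_mul (h : IsDescentRoot σ) {x y : R} (hx : ¬ σ ∣ x)
    (hd : 2 ∣ x * y) : 2 ∣ y :=
  h.two_dvd_pow_three.trans (h.pow_dvd_of_dvd_mul hx (h.pow_three_dvd_two.trans hd))

lemma two_dvd_of_four_dvd (h : IsDescentRoot σ) {w c : R} (hd : 4 ∣ w * (w + 2 * c)) :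
    2 ∣ w := by
  obtain ⟨m, hm⟩ := hd
  have h2 := h.two_eq
  set t := σ ^ 2 + 2 * σ - 1
  have h0 := h.prime.ne_zero
  have key : ∀ {x y z : R}, x * (x + σ * y) = σ * z → σ ∣ x := fun {x y z} e => by
    rcases h.prime.dvd_or_dvd (Dvd.intro z e.symm) with hx | hx
    · exact hx
    · exact (dvd_add_left (Dvd.intro y rfl)).1 hx
  obtain ⟨w, rfl⟩ := key (x := w) (y := σ ^ 2 * t * c) (z := 2 * σ ^ 2 * t * m) (by
    linear_combination hm + (2 * m - c * w) * h2)
  have hm₁ : w * (w + σ * (σ * t * c)) = σ * (2 * t * m) := by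
    apply mul_left_cancel₀ (pow_ne_zero 2 h0)
    linear_combination hm + (2 * m - c * (σ * w)) * h2
  obtain ⟨w, rfl⟩ := key hm₁
  have hm₂ : w * (w + σ * (t * c)) = σ * (σ * t ^ 2 * m) := by
    apply mul_left_cancel₀ (pow_ne_zero 2 h0)
    linear_combination hm₁ + σ * t * m * h2
  obtain ⟨w, rfl⟩ := key hm₂
  refine h.two_dvd_pow_three.trans ⟨w, by ring⟩

end IsDescentRoot

/-- Coprime factors of a square in a principal ideal domain. -/
lemma exists_unit_mul_sq {R : Type*} [CommRing R] [IsDomain R] [IsPrincipalIdealRing R]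
    {x y z : R} (hc : IsCoprime x y) (hz : x * y = z ^ 2) :
    ∃ (e : Rˣ) (p q : R), x = e * p ^ 2 ∧ y = (e⁻¹ : Rˣ) * q ^ 2 ∧ z = p * q := by
  obtain ⟨p, e, hp⟩ := exists_associated_pow_of_mul_eq_pow' hc hz
  obtain ⟨q, e', hq⟩ := exists_associated_pow_of_mul_eq_pow' hc.symm
    (show y * x = z ^ 2 by rw [mul_comm, hz])
  by_cases hp0 : p = 0
  · subst hp0
    have hx : x = 0 := by simpa using hp.symm
    subst hx
    obtain ⟨v, rfl⟩ := isCoprime_zero_left.1 hc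
    refine ⟨v⁻¹, 0, 1, by simp, by simp, ?_⟩
    simpa using hz.symm
  by_cases hq0 : q = 0
  · subst hq0
    have hy : y = 0 := by simpa using hq.symm
    subst hy
    obtain ⟨v, rfl⟩ := isCoprime_zero_right.1 hc
    refine ⟨v, 1, 0, by simp, by simp, ?_⟩
    simpa using hz.symm
  have hd : (p * q) ^ 2 ∣ z ^ 2 := ⟨e * e', by rw [← hz, ← hp, ← hq]; ring⟩
  obtain ⟨t, rfl⟩ : p * q ∣ z :=
    (IsIntegrallyClosed.pow_dvd_pow_iff two_ne_zero).1 hd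
  have ht : t ^ 2 = e * e' := by
    apply mul_left_cancel₀ (pow_ne_zero 2 (mul_ne_zero hp0 hq0))
    linear_combination -hz - q ^ 2 * e' * hp - x * hq
  refine ⟨e, p, q * t, ?_, ?_, by ring⟩
  · rw [← hp]; ring
  · rw [mul_pow, ht, ← hq]
    linear_combination -(q ^ 2 * e' : R) * e.inv_mul

/-- A primitive solution `(a, b)` of `γ² = u²b⁴ - 2σua²b² - a⁴`. -/
def QuarticPoint {R : Type*} [CommRing R] (σ u a b : R) : Prop :=
  IsCoprime a b ∧ ∃ γ, γ ^ 2 = u ^ 2 * b ^ 4 - 2 * σ * u * a ^ 2 * b ^ 2 - a ^ 4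

namespace IsDescentRoot

variable {R : Type*} [CommRing R] [IsDomain R] [IsPrincipalIdealRing R] {σ : R}

lemma isCoprime_of_forall_prime (h : IsDescentRoot σ) {x y a b : R} (hab : IsCoprime a b)
    (H : ∀ π, Prime π → π ∣ x → π ∣ y → π ∣ a ∧ π ∣ b) : IsCoprime x y := by
  have main : ∀ π, Prime π → π ∣ x → π ∣ y → False := fun π hπ hx hy =>
    hπ.not_isUnit (hab.isUnit_of_dvd' (H π hπ hx hy).1 (H π hπ hx hy).2)
  refine isCoprime_of_prime_dvd ?_ fun π hπ hx hy => main π hπ hx hy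
  rintro ⟨rfl, rfl⟩
  exact main σ h.prime (dvd_zero σ) (dvd_zero σ)

/-- On a point of the quartic, `σ` divides the first coordinate. -/
lemma dvd_of_quarticPoint (h : IsDescentRoot σ) {u : Rˣ} {a b : R}
    (hs : QuarticPoint σ u a b) : σ ∣ a := by
  by_contra ha
  obtain ⟨hab, γ, hγ⟩ := hs
  set f := (u : R) * b ^ 2 - σ * a ^ 2 + γ with hf
  set g := (u : R) * b ^ 2 - σ * a ^ 2 - γ with hg
  have hfg : f * g = h.eta * a ^ 4 := by
    rw [hf, hg, coe_eta]; linear_combination -hγ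
  have hsum : f + g = 2 * (u * b ^ 2 - σ * a ^ 2) := by rw [hf, hg]; ring
  have hσ : ¬ σ ∣ f * g := hfg ▸ h.not_dvd_mul (h.not_dvd_unit _) (h.not_dvd_pow ha 4)
  have hcop : IsCoprime f g := by
    refine h.isCoprime_of_forall_prime hab fun π hπ h₁ h₂ => ?_
    have hπa : π ∣ a := by
      have : π ∣ h.eta * a ^ 4 := hfg ▸ h₁.mul_right g
      exact hπ.dvd_of_dvd_pow ((Units.dvd_mul_left).1 this)
    refine ⟨hπa, ?_⟩
    have h3 : π ∣ 2 * (u * b ^ 2 - σ * a ^ 2) := hsum ▸ dvd_add h₁ h₂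
    rcases hπ.dvd_or_dvd h3 with h4 | h4
    · exfalso
      rw [h.two_eq, show σ ^ 3 * (σ ^ 2 + 2 * σ - 1) = σ ^ 3 * (-(h.eta⁻¹ : Rˣ) : R) by
        change _ = σ ^ 3 * -(1 - 2 * σ - σ ^ 2); ring] at h4
      rw [mul_neg, dvd_neg, Units.dvd_mul_right] at h4
      have h5 := hπ.dvd_of_dvd_pow h4
      have h6 : σ ∣ π := (hπ.irreducible.dvd_symm h.prime.irreducible h5)
      exact hσ ((h6.trans h₁).mul_right g)
    · have h5 : π ∣ u * b ^ 2 :=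
        (dvd_sub_left ((dvd_pow hπa two_ne_zero).mul_left σ)).1 h4
      exact hπ.dvd_of_dvd_pow ((Units.dvd_mul_left).1 h5)
  set g' := ((h.eta⁻¹ : Rˣ) : R) * g with hg'
  have hgg' : g = h.eta * g' := by rw [hg', ← mul_assoc, Units.mul_inv, one_mul]
  have hcop' : IsCoprime f g' :=
    IsCoprime.of_isCoprime_of_dvd_right hcop ⟨h.eta, by rw [hgg']; ring⟩
  obtain ⟨e, c, d, hc, hd, hcd⟩ := exists_unit_mul_sq hcop' (z := a ^ 2) (by
    apply mul_left_cancel₀ h.eta.ne_zero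
    linear_combination hfg - f * hgg')
  have hc0 : ¬ σ ∣ c := fun hd =>
    hσ (hc ▸ ((hd.trans (dvd_pow_self c two_ne_zero)).mul_left _).mul_right g)
  have hcd' : IsCoprime c d :=
    (hcop'.of_isCoprime_of_dvd_left ⟨e * c, by rw [hc]; ring⟩).of_isCoprime_of_dvd_right
      ⟨(e⁻¹ : Rˣ) * d, by rw [hd]; ring⟩
  obtain ⟨e', r, s, hr, hs, hrs⟩ := exists_unit_mul_sq hcd' (z := a) hcd.symm
  have hr0 : ¬ σ ∣ r := fun hd => ha (hrs ▸ hd.mul_right s)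
  have hs0 : ¬ σ ∣ s := fun hd => ha (hrs ▸ hd.mul_left r)
  obtain ⟨i, hi⟩ := h.sq_dvd_unit_sub_one (e * e' ^ 2)
  obtain ⟨j, hj⟩ := h.sq_dvd_sq_sub_one hr0
  obtain ⟨k, hk⟩ := h.sq_dvd_sq_sub_one hs0
  obtain ⟨t, ht⟩ := h.pow_three_dvd_two
  have key : ((e * e' ^ 2 : Rˣ) : R) ^ 2 * r ^ 4 + h.eta * s ^ 4 =
      ((e * e' ^ 2 : Rˣ) : R) * (2 * (u * b ^ 2 - σ * a ^ 2)) := by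
    rw [← hsum, hgg', hd, hc, hr, hs]
    push_cast
    linear_combination (-(h.eta * s ^ 4) : R) *
      (e.mul_inv * (e' * (e'⁻¹ : Rˣ)) ^ 2 + e'.mul_inv * (e' * (e'⁻¹ : Rˣ) + 1))
  rw [coe_eta] at key
  set E := ((e * e' ^ 2 : Rˣ) : R)
  set w := (u * b ^ 2 - σ * a ^ 2 : R)
  have h32 : σ ^ 3 ∣ σ ^ 2 := by
    set m := i + j + σ ^ 2 * i * j
    have e₁ : E * r ^ 2 = 1 + σ ^ 2 * m := by linear_combination r ^ 2 * hi + (σ ^ 2 * i + 1) * hj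
    refine ⟨t * (E * w - σ ^ 2 * m - 1 - σ ^ 2 * k * (σ ^ 2 + 1))
      - σ * m ^ 2 - σ * (σ ^ 2 + 1) * k ^ 2, ?_⟩
    linear_combination key - (E * r ^ 2 + 1 + σ ^ 2 * m) * e₁
      - (σ ^ 2 + 1) * (s ^ 2 + 1 + σ ^ 2 * k) * hk
      + (E * w - σ ^ 2 * m - 1 - σ ^ 2 * k * (σ ^ 2 + 1)) * ht
  rw [pow_dvd_pow_iff h.prime.ne_zero h.prime.not_isUnit] at h32
  omega

/-- Coprime factorization of `ã² = u c d` where `c + 2σd` is a difference of coprime factors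
of `d²`. -/
lemma exists_quartic_of_factors (h : IsDescentRoot σ) {u : Rˣ} {c d t B B' : R}
    (hcd : IsCoprime c d) (hc : ¬ σ ∣ c) (hB : ¬ σ ∣ B) (ht : t ^ 2 = u * c * d)
    (hBB : B * B' = d ^ 2) (hsub : B - B' = c + 2 * σ * d) :
    ∃ (ρ f : Rˣ) (p r s : R), IsCoprime s p ∧ ¬ σ ∣ p ∧ ¬ σ ∣ r ∧ f * t = p * r * s ∧
      ρ * u ^ 2 * r ^ 2 = ρ ^ 2 * u ^ 2 * p ^ 4 - 2 * σ * ρ * u * p ^ 2 * s ^ 2 - s ^ 4 := by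
  have hcop : IsCoprime B B' := by
    refine h.isCoprime_of_forall_prime hcd fun π hπ h₁ h₂ => ?_
    have hπd : π ∣ d := hπ.dvd_of_dvd_pow (hBB ▸ h₁.mul_right B')
    refine ⟨?_, hπd⟩
    have := hsub ▸ dvd_sub h₁ h₂
    exact (dvd_add_left (hπd.mul_left _)).1 this
  obtain ⟨e, x, y, hx, hy, hxy⟩ := exists_unit_mul_sq hcop hBB
  subst hxy
  have hxy : IsCoprime x y :=
    (hcop.of_isCoprime_of_dvd_left ⟨e * x, by rw [hx]; ring⟩).of_isCoprime_of_dvd_right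
      ⟨(e⁻¹ : Rˣ) * y, by rw [hy]; ring⟩
  have hcx : IsCoprime c x := hcd.of_mul_right_left
  have hcy : IsCoprime c y := hcd.of_mul_right_right
  obtain ⟨k, P, s, hP, hs, hPs⟩ := exists_unit_mul_sq (z := t) (x := c * x) (y := u * y)
    (by
      rw [isCoprime_mul_unit_left_right u.isUnit]
      exact hcy.mul_left hxy) (by linear_combination -ht)
  obtain ⟨f, r, p, hr, hp, hrp⟩ := exists_unit_mul_sq (z := P) (x := c)
    (y := (k⁻¹ : Rˣ) * x)
    (by rwa [isCoprime_mul_unit_left_right (k⁻¹).isUnit]) (by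
      linear_combination ((k⁻¹ : Rˣ) : R) * hP + P ^ 2 * k.inv_mul)
  have hx0 : ¬ σ ∣ x := fun hd => hB (hx ▸ (dvd_pow hd two_ne_zero).mul_left _)
  have hr0 : ¬ σ ∣ r := fun hd => hc (hr ▸ (dvd_pow hd two_ne_zero).mul_left _)
  have e₁ : (f : R) * x = k * p ^ 2 := by
    linear_combination f * k * hp + p ^ 2 * k * f.mul_inv - f * x * k.mul_inv
  have e₂ : (k : R) * u * y = s ^ 2 := by
    linear_combination k * hs + s ^ 2 * k.mul_inv
  have e₄ : (e : R) * c = e ^ 2 * x ^ 2 - 2 * σ * e * x * y - y ^ 2 := by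
    linear_combination -(e : R) * hsub + e * hx - e * hy - y ^ 2 * e.mul_inv
  obtain ⟨ρ, e₃⟩ : ∃ ρ : Rˣ, (f : R) * ρ = e * k ^ 2 :=
    ⟨f⁻¹ * (e * k ^ 2), by push_cast; linear_combination (e * k ^ 2 : R) * f.mul_inv⟩
  have hp0 : ¬ σ ∣ p := fun hd =>
    h.not_dvd_mul (h.not_dvd_unit f) hx0 (e₁ ▸ (dvd_pow hd two_ne_zero).mul_left _)
  have hsp : IsCoprime s p := by
    refine h.isCoprime_of_forall_prime hxy fun π hπ h₁ h₂ => ⟨?_, ?_⟩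
    · exact Units.dvd_mul_left.1 (e₁ ▸ (dvd_pow h₂ two_ne_zero).mul_left (k : R) : π ∣ f * x)
    · refine Units.dvd_mul_left (u := k * u) |>.1 ?_
      push_cast
      exact e₂ ▸ dvd_pow h₁ two_ne_zero
  refine ⟨ρ, f, p, f * r, s, hsp, hp0, h.not_dvd_mul (h.not_dvd_unit f) hr0, ?_, ?_⟩
  · rw [hPs, hrp]; ring
  · apply mul_left_cancel₀ (pow_ne_zero 2 k.ne_zero)
    linear_combination (-k ^ 2 * f * ρ * u ^ 2 : R) * hr
      + (k ^ 2 * u ^ 2 * c - u ^ 2 * x ^ 2 * (f * ρ + e * k ^ 2)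
        + 2 * σ * k ^ 2 * u ^ 2 * x * y : R) * e₃
      + (ρ ^ 2 * u ^ 2 * (f * x + k * p ^ 2) - 2 * σ * k ^ 2 * ρ * u ^ 2 * y : R) * e₁
      - (2 * σ * k ^ 2 * ρ * u * p ^ 2 + k ^ 2 * (k * u * y + s ^ 2) : R) * e₂
      + (k ^ 4 * u ^ 2 : R) * e₄

lemma exists_quartic_of_sq_add (h : IsDescentRoot σ) {u : Rˣ} {b c d t : R}
    (hcd : IsCoprime c d) (hc : ¬ σ ∣ c) (ht : t ^ 2 = u * c * d)
    (hb : b ^ 2 = (c + 2 * σ * d) ^ 2 + 4 * d ^ 2) :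
    σ ∣ t ∧ ∃ (ρ f : Rˣ) (p r s : R), IsCoprime s p ∧ ¬ σ ∣ p ∧ ¬ σ ∣ r ∧ f * t = p * r * s ∧
      ρ * u ^ 2 * r ^ 2 =
        ρ ^ 2 * u ^ 2 * p ^ 4 - 2 * σ * ρ * u * p ^ 2 * s ^ 2 - s ^ 4 := by
  set g := c + 2 * σ * d with hg
  have hg0 : ¬ σ ∣ g := fun hd =>
    hc ((dvd_add_left ((h.dvd_two_mul (σ * d)).trans (dvd_of_eq (by ring)))).1 hd)
  obtain ⟨B', hB'⟩ : 2 ∣ b - g :=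
    h.two_dvd_of_four_dvd (c := g) ⟨d ^ 2, by linear_combination hb⟩
  obtain ⟨B, hB⟩ : ∃ B, B = B' + g := ⟨_, rfl⟩
  have hBB : B * B' = d ^ 2 := by
    apply mul_left_cancel₀ h.four_ne_zero'
    linear_combination 4 * B' * hB - (b + g + 2 * B') * hB' + hb
  have hsub : B - B' = g := by rw [hB]; ring
  have hσ : σ ∣ d := by
    by_contra hd
    have h2 : ¬ σ ∣ B * B' := hBB ▸ h.not_dvd_pow hd 2
    apply hg0
    rw [← hsub]
    exact h.dvd_sub_of_not_dvd (fun h₁ => h2 (h₁.mul_right _)) (fun h₁ => h2 (h₁.mul_left _))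
  refine ⟨h.prime.dvd_of_dvd_pow (ht ▸ hσ.mul_left _), ?_⟩
  by_cases hB0 : σ ∣ B
  · have hB0' : ¬ σ ∣ -B' := fun hd =>
      hg0 (hsub ▸ dvd_sub hB0 ((dvd_neg).1 hd))
    exact h.exists_quartic_of_factors (B' := -B) hcd hc hB0' ht
      (by linear_combination hBB) (by linear_combination hsub)
  · exact h.exists_quartic_of_factors hcd hc hB0 ht hBB hsub

lemma exists_quartic_of_sum (h : IsDescentRoot σ) {u : Rˣ} {b t A A' : R}
    (hcop : IsCoprime A A') (hA : ¬ σ ∣ A) (hb : ¬ σ ∣ b)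
    (hmul : A * A' = 4 * h.eta * t ^ 4) (hsum : A + A' = u * b ^ 2 - 4 * σ * t ^ 2) :
    σ ∣ t ∧ ∃ (ρ f : Rˣ) (p r s : R), IsCoprime s p ∧ ¬ σ ∣ p ∧ ¬ σ ∣ r ∧ f * t = p * r * s ∧
      ρ * u ^ 2 * r ^ 2 =
        ρ ^ 2 * u ^ 2 * p ^ 4 - 2 * σ * ρ * u * p ^ 2 * s ^ 2 - s ^ 4 := by
  set D := ((h.eta⁻¹ : Rˣ) : R) * A' with hD
  have hAD : A' = h.eta * D := by rw [hD, ← mul_assoc, Units.mul_inv, one_mul]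
  have hcop' : IsCoprime A D := hcop.of_isCoprime_of_dvd_right ⟨h.eta, by rw [hAD]; ring⟩
  obtain ⟨e, c, d, hc, hd, hcd⟩ := exists_unit_mul_sq hcop' (z := 2 * t ^ 2) (by
    apply mul_left_cancel₀ h.eta.ne_zero
    linear_combination hmul - A * hAD)
  have hc0 : ¬ σ ∣ c := fun hd => hA (hc ▸ (dvd_pow hd two_ne_zero).mul_left _)
  obtain ⟨d, rfl⟩ : 2 ∣ d := h.two_dvd_of_dvd_mul hc0 ⟨t ^ 2, hcd.symm⟩
  replace hcd : t ^ 2 = c * d := by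
    apply mul_left_cancel₀ h.two_ne_zero'
    linear_combination hcd
  obtain ⟨v, hv⟩ : ∃ v : Rˣ, u⁻¹ * e = v ^ 2 := by
    refine h.unit_eq_sq hc0 hb ⟨(u⁻¹ : Rˣ) * (-σ * t ^ 2 - h.eta * (e⁻¹ : Rˣ) * d ^ 2), ?_⟩
    push_cast
    linear_combination ((u⁻¹ : Rˣ) : R) * (hsum - hc - hAD - h.eta * hd) + b ^ 2 * u.inv_mul
  have he : (e : R) = u * v ^ 2 := by
    have : e = u * v ^ 2 := by rw [← hv]; group
    exact_mod_cast congrArg Units.val this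
  have he' : ((e⁻¹ : Rˣ) : R) * (u * v ^ 2) = 1 := by rw [← he, Units.inv_mul]
  obtain ⟨d, rfl⟩ : ∃ x, d = u * v * x := (u * v).isUnit.dvd.imp fun x hx => by
    simpa using hx
  refine h.exists_quartic_of_sq_add (b := b) (c := v * c) (d := d) ?_
    (h.not_dvd_mul (h.not_dvd_unit v) hc0) (by linear_combination hcd) ?_
  · refine (isCoprime_mul_unit_left_left v.isUnit _ _).2 ?_
    exact (hcop'.of_isCoprime_of_dvd_left ⟨e * c, by rw [hc]; ring⟩).of_isCoprime_of_dvd_right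
      ⟨(e⁻¹ : Rˣ) * (4 * u ^ 2 * v ^ 2 * d), by rw [hd]; ring⟩
  · apply mul_left_cancel₀ u.ne_zero
    rw [coe_eta] at hAD
    linear_combination -hsum + hc + hAD + (σ ^ 2 + 1) * hd + c ^ 2 * he
      + 4 * (σ ^ 2 + 1) * u * d ^ 2 * he' + 4 * σ * hcd

/-- The first descent on a point of the quartic with `a = 2t`. -/
lemma exists_quartic_of_quarticPoint (h : IsDescentRoot σ) {u : Rˣ} {b t : R}
    (hs : QuarticPoint σ u (2 * t) b) (hb : ¬ σ ∣ b) :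
    σ ∣ t ∧ ∃ (ρ f : Rˣ) (p r s : R), IsCoprime s p ∧ ¬ σ ∣ p ∧ ¬ σ ∣ r ∧ f * t = p * r * s ∧
      ρ * u ^ 2 * r ^ 2 =
        ρ ^ 2 * u ^ 2 * p ^ 4 - 2 * σ * ρ * u * p ^ 2 * s ^ 2 - s ^ 4 := by
  obtain ⟨hab, γ, hγ⟩ := hs
  set w := (u : R) * b ^ 2 - 4 * σ * t ^ 2 with hw
  obtain ⟨A, hA⟩ : 2 ∣ γ - w :=
    h.two_dvd_of_four_dvd (c := w) ⟨-4 * (σ ^ 2 + 1) * t ^ 4, by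
      rw [hw]; linear_combination hγ⟩
  obtain ⟨A', hA'⟩ : ∃ A', A' = A + w := ⟨_, rfl⟩
  have hmul : A' * -A = 4 * h.eta * t ^ 4 := by
    apply mul_left_cancel₀ h.four_ne_zero'
    rw [coe_eta]
    linear_combination -4 * A * hA' + (γ + w + 2 * A) * hA - hγ
      + (w + 4 * σ * t ^ 2 + u * b ^ 2) * hw
  have hsum : A' + -A = u * b ^ 2 - 4 * σ * t ^ 2 := by rw [hA']; ring
  have hcop : IsCoprime A' (-A) := by
    refine h.isCoprime_of_forall_prime hab fun π hπ h₁ h₂ => ?_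
    have hπt : π ∣ 2 * t := by
      have : π ∣ h.eta * ((2 * t) ^ 2 * t ^ 2) := by
        convert h₁.mul_right (-A) using 1
        rw [hmul]; ring
      rcases hπ.dvd_or_dvd (Units.dvd_mul_left.1 this) with h3 | h3
      · exact hπ.dvd_of_dvd_pow h3
      · exact (hπ.dvd_of_dvd_pow h3).mul_left _
    refine ⟨hπt, ?_⟩
    have h3 : π ∣ u * b ^ 2 - 4 * σ * t ^ 2 := hsum ▸ dvd_add h₁ h₂
    have h4 : π ∣ u * b ^ 2 :=
      (dvd_sub_left ((hπt.mul_left (2 * σ * t)).trans (dvd_of_eq (by ring)))).1 h3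
    exact hπ.dvd_of_dvd_pow (Units.dvd_mul_left.1 h4)
  by_cases h0 : σ ∣ A'
  · have h0' : ¬ σ ∣ -A := fun hd =>
      h.prime.not_isUnit (hcop.isUnit_of_dvd' h0 hd)
    exact h.exists_quartic_of_sum hcop.symm h0' hb (by linear_combination hmul)
      (by linear_combination hsum)
  · exact h.exists_quartic_of_sum hcop h0 hb hmul hsum

lemma exists_quartic_of_pow (h : IsDescentRoot σ) {u : Rˣ} {n : ℕ} {a b : R}
    (hs : QuarticPoint σ u (σ ^ (n + 3) * a) b) (ha : ¬ σ ∣ a) (hb : ¬ σ ∣ b) :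
    n ≠ 0 ∧ ∃ (ρ : Rˣ) (p r s : R), IsCoprime (σ ^ n * s) p ∧ ¬ σ ∣ p ∧ ¬ σ ∣ r ∧ ¬ σ ∣ s ∧
      ρ * u ^ 2 * r ^ 2 = ρ ^ 2 * u ^ 2 * p ^ 4 - 2 * σ * ρ * u * p ^ 2 * (σ ^ n * s) ^ 2
        - (σ ^ n * s) ^ 4 := by
  have hηa : ¬ σ ∣ h.eta * a := h.not_dvd_mul (h.not_dvd_unit _) ha
  rw [show σ ^ (n + 3) * a = 2 * (-σ ^ n * (h.eta * a)) by
    rw [coe_eta]; linear_combination σ ^ n * a * h.root] at hs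
  obtain ⟨ht, ρ, f, p, r, s, hsp, hp, hr, hf, heq⟩ := h.exists_quartic_of_quarticPoint hs hb
  refine ⟨?_, ?_⟩
  · rintro rfl
    exact hηa (by simpa using ht)
  obtain ⟨s, rfl⟩ : σ ^ n ∣ s :=
    h.pow_dvd_of_dvd_mul (h.not_dvd_mul hp hr) ⟨-(f * (h.eta * a)), by rw [← hf]; ring⟩
  refine ⟨ρ, p, r, s, hsp, hp, hr, fun hd => ?_, heq⟩
  have : f * (h.eta * a) = -(p * r * s) := by
    apply mul_left_cancel₀ (pow_ne_zero n h.prime.ne_zero)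
    linear_combination -hf
  exact h.not_dvd_mul (h.not_dvd_unit f) hηa (this ▸ dvd_neg.2 (hd.mul_left _))

lemma exists_smaller_quarticPoint (h : IsDescentRoot σ) {u : Rˣ} {n : ℕ} {a b : R} (hn : 2 ≤ n)
    (hs : QuarticPoint σ u (σ ^ (n + 3) * a) b) (ha : ¬ σ ∣ a) (hb : ¬ σ ∣ b) :
    ∃ a' b', QuarticPoint σ u (σ ^ n * a') b' ∧ ¬ σ ∣ a' ∧ ¬ σ ∣ b' := by
  obtain ⟨-, ρ, p, r, s, hsp, hp, hr, hs, heq⟩ := h.exists_quartic_of_pow hs ha hb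
  obtain ⟨z, hz⟩ : σ ^ 2 ∣ σ ^ n * s := (pow_dvd_pow σ hn).mul_right s
  obtain ⟨v, rfl⟩ : ∃ v : Rˣ, ρ = v ^ 2 := by
    refine h.unit_eq_sq (x := p ^ 2) (h.not_dvd_pow hp 2) hr
      ((Units.dvd_mul_left (u := ρ * u ^ 2)).1 ?_)
    rw [hz] at heq
    refine ⟨-(σ ^ 2 + 1) * σ ^ 2 * ρ * u * p ^ 2 * z ^ 2 + (σ ^ 2 + 1) ^ 2 * σ ^ 2 * z ^ 4, ?_⟩
    push_cast
    linear_combination -heq + (2 * σ ^ 2 * ρ * u * p ^ 2 * z ^ 2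
      + (σ ^ 3 - 2 * (σ ^ 2 + 1)) * σ ^ 2 * z ^ 4 : R) * h.root
  refine ⟨s, v * p, ⟨?_, u * v * r, ?_⟩, hs, h.not_dvd_mul (h.not_dvd_unit v) hp⟩
  · exact (isCoprime_mul_unit_left_right v.isUnit _ _).2 hsp
  · push_cast at heq
    linear_combination heq

lemma exists_quarticPoint_of_sq {u a b γ : R} (hb : b ≠ 0)
    (hγ : γ ^ 2 = u ^ 2 * b ^ 4 - 2 * σ * u * a ^ 2 * b ^ 2 - a ^ 4) :
    ∃ g a' b', a = g * a' ∧ b = g * b' ∧ QuarticPoint σ u a' b' := by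
  obtain ⟨a', ha⟩ := IsBezout.gcd_dvd_left a b
  obtain ⟨b', hb'⟩ := IsBezout.gcd_dvd_right a b
  obtain ⟨x, y, hxy⟩ := IsBezout.gcd_eq_sum a b
  set g := IsBezout.gcd a b
  have hg : g ≠ 0 := fun h0 => hb (by rw [hb', h0, zero_mul])
  refine ⟨g, a', b', ha, hb', ⟨x, y, ?_⟩, ?_⟩
  · apply mul_left_cancel₀ hg
    linear_combination hxy - x * ha - y * hb'
  · obtain ⟨δ, rfl⟩ : g ^ 2 ∣ γ := (IsIntegrallyClosed.pow_dvd_pow_iff two_ne_zero).1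
      ⟨u ^ 2 * b' ^ 4 - 2 * σ * u * a' ^ 2 * b' ^ 2 - a' ^ 4, by
        rw [hγ, ha, hb']; ring⟩
    refine ⟨δ, mul_left_cancel₀ (pow_ne_zero 4 hg) ?_⟩
    linear_combination hγ.trans (by rw [ha, hb'])

lemma not_twisted_of_dvd (h : IsDescentRoot σ) {a b γ : R} (ha : σ ∣ a) (hb : ¬ σ ∣ b)
    (hγ : γ ^ 2 = (σ ^ 2 + 1) * (b ^ 4 - 2 * σ * a ^ 2 * b ^ 2 - a ^ 4)) : False := by
  have h₁ : ¬ σ ∣ h.eta * (b ^ 2 - a ^ 2) :=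
    h.not_dvd_mul (h.not_dvd_unit _) fun hd => h.not_dvd_pow hb 2
      ((dvd_sub_left (dvd_pow ha two_ne_zero)).1 hd)
  have hγ0 : ¬ σ ∣ γ := fun hd => by
    have h2 : σ ∣ h.eta * (b ^ 4 - 2 * σ * a ^ 2 * b ^ 2 - a ^ 4) :=
      hγ ▸ dvd_pow hd two_ne_zero
    have h3 := Units.dvd_mul_left.1 h2
    have h4 := (dvd_sub_left (dvd_pow ha four_ne_zero)).1 h3
    exact h.not_dvd_pow hb 4
      ((dvd_sub_left (((dvd_pow ha two_ne_zero).mul_left _).mul_right _)).1 h4)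
  have h₂ : ¬ σ ∣ σ ^ 2 * a * b + γ := fun hd =>
    hγ0 ((dvd_add_right ((ha.mul_left _).mul_right b)).1 hd)
  obtain ⟨g, a', b', ha', hb', hs⟩ := exists_quarticPoint_of_sq
    (b := σ ^ 2 * a * b + γ) (fun h0 => h₂ (h0 ▸ dvd_zero σ)) (h.translate_eq hγ)
  exact h₁ (ha' ▸ (h.dvd_of_quarticPoint (u := h.eta) hs).mul_left g)

lemma not_quarticPoint_pow_four (h : IsDescentRoot σ) {a b : R}
    (hs : QuarticPoint σ h.eta (σ ^ 4 * a) b) (ha : ¬ σ ∣ a) (hb : ¬ σ ∣ b) : False := by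
  obtain ⟨-, ρ, p, r, s, hsp, hp, hr, hs, heq⟩ := h.exists_quartic_of_pow (n := 1) hs ha hb
  obtain ⟨x, hx⟩ := h.sq_dvd_unit_sub_one (ρ * h.eta)
  obtain ⟨y, hy⟩ := h.sq_dvd_sq_sub_one (h.not_dvd_pow hs 2)
  obtain ⟨v, rfl⟩ : ∃ v : Rˣ, ρ = h.eta * v ^ 2 := by
    refine h.unit_eq_eta_sq (x := p ^ 2) (h.not_dvd_pow hp 2) hr
      ((Units.dvd_mul_left (u := ρ * h.eta ^ 2)).1 ?_)
    push_cast at hx ⊢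
    rw [coe_eta] at *
    refine ⟨-(σ ^ 2 + 1) ^ 2 * (ρ * p ^ 2 * s ^ 2 + x - y), ?_⟩
    linear_combination -heq + 2 * (σ ^ 2 + 1) * σ * (hx - hy)
      + (2 * ρ * (σ ^ 2 + 1) * p ^ 2 * s ^ 2 + σ * s ^ 4 + 2 * (σ ^ 2 + 1) * (x - y) : R) * h.root
  refine h.not_twisted_of_dvd (a := σ * s) (b := h.eta * v * p) (γ := h.eta ^ 2 * v * r)
    (dvd_mul_right σ s) (h.not_dvd_mul (by exact_mod_cast h.not_dvd_unit (h.eta * v)) hp) ?_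
  push_cast at heq
  rw [coe_eta] at *
  linear_combination (σ ^ 2 + 1) * heq

lemma not_quarticPoint_eta (h : IsDescentRoot σ) (k : ℕ) {a b : R}
    (hs : QuarticPoint σ h.eta (σ ^ (3 * k + 4) * a) b) (ha : ¬ σ ∣ a) (hb : ¬ σ ∣ b) :
    False := by
  induction k generalizing a b with
  | zero => exact h.not_quarticPoint_pow_four hs ha hb
  | succ k ih =>
    obtain ⟨a', b', hs', ha', hb'⟩ := h.exists_smaller_quarticPoint
      (n := 3 * k + 4) (by omega) hs ha hb
    exact ih hs' ha' hb'

lemma not_quarticPoint (h : IsDescentRoot σ) (u : Rˣ) (k : ℕ) {a b : R}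
    (hs : QuarticPoint σ u (σ ^ (3 * k + 3) * a) b) (ha : ¬ σ ∣ a) (hb : ¬ σ ∣ b) :
    False := by
  induction k generalizing a b with
  | zero => exact (h.exists_quartic_of_pow hs ha hb).1 rfl
  | succ k ih =>
    obtain ⟨a', b', hs', ha', hb'⟩ := h.exists_smaller_quarticPoint
      (n := 3 * k + 3) (by omega) hs ha hb
    exact ih hs' ha' hb'

end IsDescentRoot

lemma exists_two_pow_mul {n : ℤ} (hn : n ≠ 0) : ∃ (k : ℕ) (c : ℤ), n = 2 ^ k * c ∧ ¬ 2 ∣ c := by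
  have : FiniteMultiplicity 2 n := Int.finiteMultiplicity_iff.2 ⟨by norm_num, hn⟩
  exact ⟨_, this.exists_eq_pow_mul_and_not_dvd⟩

lemma not_prime_dvd_of_isCoprime {R : Type*} [CommRing R] {m n : ℤ} (hmn : IsCoprime m n)
    {π : R} (hπ : Prime π)
    (hm : π ∣ (m : R)) (hn : π ∣ (n : R)) : False :=
  hπ.not_isUnit ((hmn.map (Int.castRingHom R)).isUnit_of_dvd' (by simpa using hm)
    (by simpa using hn))

lemma forty_three_dvd {R : Type*} [CommRing R] {n : ℤ} {π : R} (hπ : Prime π) (h43 : π ∣ 43)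
    (hn : π ∣ (n : R)) :
    43 ∣ n := by
  by_contra hd
  have hp : Prime (43 : ℤ) := by norm_num
  exact not_prime_dvd_of_isCoprime ((hp.irreducible.coprime_iff_not_dvd).2 hd) hπ
    (by simpa using h43) hn

namespace IsDescentRoot

variable {R : Type*} [CommRing R] [IsDomain R] [IsPrincipalIdealRing R] {σ : R}

lemma isCoprime_factors_even (h : IsDescentRoot σ) {x z y : ℤ} (hxz : IsCoprime x z)
    (hy2 : ¬ 2 ∣ y) (hy : y ^ 2 = x ^ 3 + 4 * x ^ 2 * z + 16 * z ^ 3) :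
    IsCoprime (x - 2 * σ * z : R)
      (x ^ 2 + (2 * σ + 4) * x * z + (4 * σ ^ 2 + 8 * σ) * z ^ 2) := by
  have hmul : (x - 2 * σ * z : R) *
      (x ^ 2 + (2 * σ + 4) * x * z + (4 * σ ^ 2 + 8 * σ) * z ^ 2) = y ^ 2 := by
    have := congrArg (Int.cast : ℤ → R) hy
    push_cast at this
    linear_combination (-8 * z ^ 3 : R) * h.root - this
  refine h.isCoprime_of_forall_prime (hxz.map (Int.castRingHom R)) fun π hπ h₁ h₂ => ?_
  exfalso
  have hπy : π ∣ y := hπ.dvd_of_dvd_pow (hmul ▸ h₁.mul_right _)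
  have hπz : ¬ π ∣ z := fun hd => not_prime_dvd_of_isCoprime hxz hπ
    ((dvd_sub_left (hd.mul_left _)).1 h₁) hd
  have hπ2 : ¬ π ∣ 2 := fun hd => not_prime_dvd_of_isCoprime (m := 2) (n := y)
    ((Int.prime_two.irreducible.coprime_iff_not_dvd).2 hy2) hπ (by simpa using hd) hπy
  have hπσ : ¬ π ∣ σ := fun hd => hπ2 (hd.trans h.dvd_two)
  have h₃ : π ∣ 2 ^ 2 * (σ * ((3 * σ + 4) * z ^ 2)) := by
    convert dvd_sub h₂ (h₁.mul_right (x + (4 * σ + 4) * z : R)) using 1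
    ring
  have h₄ : π ∣ 3 * σ + 4 := by
    rcases hπ.dvd_or_dvd h₃ with h₄ | h₄
    · exact (hπ2 (hπ.dvd_of_dvd_pow h₄)).elim
    rcases hπ.dvd_or_dvd h₄ with h₄ | h₄
    · exact (hπσ h₄).elim
    rcases hπ.dvd_or_dvd h₄ with h₄ | h₄
    · exact h₄
    · exact (hπz (hπ.dvd_of_dvd_pow h₄)).elim
  have h43 : π ∣ 43 := by
    refine (hπ.dvd_or_dvd (?_ : π ∣ 2 * 43)).resolve_left hπ2
    refine (h₄.mul_right (-9 * σ ^ 2 - 6 * σ + 8)).trans (dvd_of_eq ?_)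
    linear_combination -27 * h.root
  have hw : 43 ∣ 3 * x + 8 * z := forty_three_dvd hπ h43 (by
    push_cast
    convert dvd_add (h₁.mul_left 3) (h₄.mul_right (2 * z : R)) using 1
    ring)
  have hy43 := forty_three_dvd hπ h43 hπy
  obtain ⟨k, hk⟩ := hw
  obtain ⟨l, rfl⟩ := hy43
  have hz : 43 ∣ 16 * z ^ 3 := ⟨27 * l ^ 2 - 43 * k ^ 3 + 12 * k ^ 2 * z, by
    have e : 43 * (16 * z ^ 3 - 43 * (27 * l ^ 2 - 43 * k ^ 3 + 12 * k ^ 2 * z)) = 0 := by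
      linear_combination (-27 : ℤ) * hy
        - ((3 * x + 8 * z) ^ 2 + (3 * x + 8 * z) * (43 * k) + (43 * k) ^ 2
          - 12 * z * (3 * x + 8 * z + 43 * k)) * hk
    linarith⟩
  have hz' : 43 ∣ z := by
    have hp : Prime (43 : ℤ) := by norm_num
    exact hp.dvd_of_dvd_pow ((hp.dvd_or_dvd hz).resolve_left (by norm_num))
  exact hπz ((h43.trans (by simpa using (Int.castRingHom R).map_dvd hz')))

lemma isCoprime_factors_odd (h : IsDescentRoot σ) {x n y : ℤ} (hxn : IsCoprime x n)
    (hn2 : ¬ 2 ∣ n) (hy : y ^ 2 = 256 * x ^ 3 + 64 * x ^ 2 * n ^ 2 + n ^ 6)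
    {τ : R} (hτ : τ ^ 3 + 4 * τ + 4 = 0) :
    IsCoprime (n ^ 2 - 4 * τ * x : R)
      (n ^ 4 + 4 * τ * x * n ^ 2 + 16 * (τ ^ 2 + 4) * x ^ 2) := by
  have hmul : (n ^ 2 - 4 * τ * x : R) *
      (n ^ 4 + 4 * τ * x * n ^ 2 + 16 * (τ ^ 2 + 4) * x ^ 2) = y ^ 2 := by
    have := congrArg (Int.cast : ℤ → R) hy
    push_cast at this
    linear_combination (-64 * x ^ 3 : R) * hτ - this
  refine h.isCoprime_of_forall_prime (hxn.map (Int.castRingHom R)) fun π hπ h₁ h₂ => ?_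
  exfalso
  have hπy : π ∣ y := hπ.dvd_of_dvd_pow (hmul ▸ h₁.mul_right _)
  have hπx : ¬ π ∣ x := fun hd => not_prime_dvd_of_isCoprime hxn hπ hd
    (hπ.dvd_of_dvd_pow ((dvd_sub_left (hd.mul_left _)).1 h₁))
  have hπ2 : ¬ π ∣ 2 := fun hd => not_prime_dvd_of_isCoprime (m := 2) (n := n)
    ((Int.prime_two.irreducible.coprime_iff_not_dvd).2 hn2) hπ (by simpa using hd)
    (hπ.dvd_of_dvd_pow ((dvd_sub_left
      ((hd.mul_right (2 * τ * x)).trans (dvd_of_eq (by ring)))).1 h₁))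
  have h₃ : π ∣ 2 ^ 4 * ((3 * τ ^ 2 + 4) * x ^ 2) := by
    convert dvd_sub h₂ (h₁.mul_right (n ^ 2 + 8 * τ * x : R)) using 1
    ring
  have h₄ : π ∣ 3 * τ ^ 2 + 4 := by
    rcases hπ.dvd_or_dvd h₃ with h₄ | h₄
    · exact (hπ2 (hπ.dvd_of_dvd_pow h₄)).elim
    rcases hπ.dvd_or_dvd h₄ with h₄ | h₄
    · exact h₄
    · exact (hπx (hπ.dvd_of_dvd_pow h₄)).elim
  have h43 : π ∣ 43 := by
    refine (hπ.dvd_or_dvd (?_ : π ∣ 2 ^ 2 * 43)).resolve_left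
      (fun hd => hπ2 (hπ.dvd_of_dvd_pow hd))
    refine (h₄.mul_right (6 * τ ^ 2 - 9 * τ + 16)).trans (dvd_of_eq ?_)
    linear_combination (18 * τ - 27) * hτ
  have h₅ : π ∣ 2 * τ + 3 := by
    refine (hπ.dvd_or_dvd (?_ : π ∣ 2 ^ 2 * (2 * τ + 3))).resolve_left
      (fun hd => hπ2 (hπ.dvd_of_dvd_pow hd))
    refine (h₄.mul_right (-τ)).trans (dvd_of_eq ?_)
    linear_combination -3 * hτ
  have hw : 43 ∣ n ^ 2 + 6 * x := forty_three_dvd hπ h43 (by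
    push_cast
    convert dvd_add h₁ (h₅.mul_right (2 * x : R)) using 1
    ring)
  have hy43 := forty_three_dvd hπ h43 hπy
  obtain ⟨k, hk⟩ := hw
  obtain ⟨l, rfl⟩ := hy43
  have hn : n ^ 2 = 43 * k - 6 * x := by linear_combination hk
  have hx : 43 ∣ 8 * x ^ 3 := ⟨43 * k ^ 3 - 18 * k ^ 2 * x + 4 * k * x ^ 2 - l ^ 2, by
    have hy' : (43 * l) ^ 2 = 256 * x ^ 3 + 64 * x ^ 2 * (43 * k - 6 * x)
        + (43 * k - 6 * x) ^ 3 := by rw [hy, ← hn]; ring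
    linarith⟩
  have hx' : 43 ∣ x := by
    have hp : Prime (43 : ℤ) := by norm_num
    exact hp.dvd_of_dvd_pow ((hp.dvd_or_dvd hx).resolve_left (by norm_num))
  exact hπx ((h43.trans (by simpa using (Int.castRingHom R).map_dvd hx')))

end IsDescentRoot

lemma isCoprime_pow_four_sub {a b : ℤ} (hab : IsCoprime a b) :
    IsCoprime (b ^ 4 - a ^ 4) (a * b) := by
  refine IsCoprime.mul_right ?_ ?_
  · have : IsCoprime (b ^ 4) a := hab.symm.pow_left
    rw [show b ^ 4 - a ^ 4 = b ^ 4 + a * -a ^ 3 by ring]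
    exact this.add_mul_left_left _
  · have : IsCoprime (-a ^ 4) b := (hab.pow_left (m := 4)).neg_left
    rw [show b ^ 4 - a ^ 4 = -a ^ 4 + b * b ^ 3 by ring]
    exact this.add_mul_left_left _

namespace IsDescentRoot

variable {R : Type*} [CommRing R] [IsDomain R] [IsPrincipalIdealRing R] {σ : R}

/-- The integral equation with `a` even has only the trivial solution. -/
lemma eq_zero_of_even (h : IsDescentRoot σ) {a b y : ℤ} (hab : IsCoprime a b) (ha : 2 ∣ a)
    (hy : y ^ 2 = (b ^ 4 - a ^ 4) ^ 3 + 4 * (b ^ 4 - a ^ 4) ^ 2 * (a * b) ^ 2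
      + 16 * ((a * b) ^ 2) ^ 3) : a = 0 := by
  by_contra ha0
  have hb2 : ¬ 2 ∣ b := fun hd => Int.prime_two.not_isUnit (hab.isUnit_of_dvd' ha hd)
  have hb : ¬ σ ∣ (b : R) := by rwa [h.dvd_intCast_iff]
  have hy2 : ¬ 2 ∣ y := by
    intro hd
    apply hb2
    refine Int.prime_two.dvd_of_dvd_pow (n := 12) ?_
    obtain ⟨a, rfl⟩ := ha
    obtain ⟨y, rfl⟩ := hd
    exact ⟨2 * y ^ 2 - (((b ^ 4 - (2 * a) ^ 4) ^ 3 - b ^ 12) / 2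
      + 2 * (b ^ 4 - (2 * a) ^ 4) ^ 2 * (2 * a * b) ^ 2 + 8 * ((2 * a * b) ^ 2) ^ 3), by
      rw [show (b ^ 4 - (2 * a) ^ 4) ^ 3 - b ^ 12 = 2 *
        (-24 * b ^ 8 * a ^ 4 + 384 * b ^ 4 * a ^ 8 - 2048 * a ^ 12) by ring,
        Int.mul_ediv_cancel_left _ two_ne_zero]
      linear_combination -hy⟩
  have hcop := h.isCoprime_factors_even ((isCoprime_pow_four_sub hab).pow_right (n := 2)) hy2 hy
  obtain ⟨e, γ, -, hγ, -, -⟩ := exists_unit_mul_sq (z := (y : R)) hcop (by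
    have := congrArg (Int.cast : ℤ → R) hy
    push_cast at this ⊢
    linear_combination (-8 * (a * b) ^ 6 : R) * h.root - this)
  push_cast at hγ
  have ha' : (2 : R) ∣ a := by simpa using (Int.castRingHom R).map_dvd ha
  obtain ⟨c, hc⟩ := ha'
  have h4 : (4 : R) ∣ e * γ ^ 2 - (b ^ 2) ^ 2 := by
    rw [← hγ, hc]
    exact ⟨-4 * c ^ 4 - 2 * σ * c ^ 2 * b ^ 2, by ring⟩
  have hγ0 : ¬ σ ∣ γ := fun hd => by
    have h₂ : σ ∣ 4 := h.dvd_two.trans ⟨2, by norm_num⟩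
    have := dvd_sub ((dvd_pow hd two_ne_zero).mul_left (e : R)) (h₂.trans h4)
    rw [sub_sub_cancel] at this
    exact h.not_dvd_pow (h.not_dvd_pow hb 2) 2 this
  obtain ⟨v, rfl⟩ := h.unit_eq_sq hγ0 (h.not_dvd_pow hb 2) h4
  have hs : QuarticPoint σ (1 : Rˣ) (a : R) b := by
    refine ⟨by simpa using hab.map (Int.castRingHom R), v * γ, ?_⟩
    push_cast at hγ ⊢
    linear_combination -hγ
  obtain ⟨k, m, rfl, hm⟩ := exists_two_pow_mul ha0
  obtain _ | k := k
  · simp at ha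
    exact hm ha
  obtain ⟨f, hf⟩ := h.two_pow_eq (k + 1)
  push_cast at hs
  rw [hf, mul_assoc] at hs
  exact h.not_quarticPoint 1 k hs
    (h.not_dvd_mul (h.not_dvd_unit f) (by rwa [h.dvd_intCast_iff])) hb

/-- The square root attached to the integral equation with `a` and `b` odd. -/
lemma exists_sq_of_odd (h : IsDescentRoot σ) {n x y : ℤ} (hxn : IsCoprime x n)
    (hn2 : ¬ 2 ∣ n) (hy : y ^ 2 = 256 * x ^ 3 + 64 * x ^ 2 * n ^ 2 + n ^ 6) :
    ∃ γ t : R, γ ^ 2 = n ^ 2 + 4 * (σ ^ 2 + 2 * σ) * x ∧ n + γ = 2 * t ∧ ¬ σ ∣ t := by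
  set τ := -(σ ^ 2 + 2 * σ) with hτdef
  have hτ : τ ^ 3 + 4 * τ + 4 = 0 := by
    rw [hτdef]; linear_combination (-σ ^ 3 - 4 * σ ^ 2 - 4 * σ + 2) * h.root
  have hn : ¬ σ ∣ (n : R) := by rwa [h.dvd_intCast_iff]
  have hcop := h.isCoprime_factors_odd hxn hn2 hy hτ
  obtain ⟨e, γ, -, hγ, -, -⟩ := exists_unit_mul_sq (z := (y : R)) hcop (by
    have := congrArg (Int.cast : ℤ → R) hy
    push_cast at this ⊢
    linear_combination (-64 * x ^ 3 : R) * hτ - this)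
  have h4 : (4 : R) ∣ e * γ ^ 2 - n ^ 2 := by
    rw [← hγ]
    exact ⟨-τ * x, by ring⟩
  have hγ0 : ¬ σ ∣ γ := fun hd => by
    have h₂ : σ ∣ 4 := h.dvd_two.trans ⟨2, by norm_num⟩
    have := dvd_sub ((dvd_pow hd two_ne_zero).mul_left (e : R)) (h₂.trans h4)
    rw [sub_sub_cancel] at this
    exact h.not_dvd_pow hn 2 this
  obtain ⟨v, rfl⟩ := h.unit_eq_sq hγ0 hn h4
  set δ := v * γ with hδ
  have hδ2 : δ ^ 2 = n ^ 2 + 4 * (σ ^ 2 + 2 * σ) * x := by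
    push_cast at hγ
    rw [hδ]; linear_combination -hγ - 4 * x * hτdef
  obtain ⟨w, hw⟩ : 2 ∣ δ - n :=
    h.two_dvd_of_four_dvd (c := n) ⟨(σ ^ 2 + 2 * σ) * x, by linear_combination hδ2⟩
  by_cases hσ : σ ∣ n + w
  · refine ⟨-δ, -w, by linear_combination hδ2, by linear_combination -hw, fun hd => hn ?_⟩
    convert dvd_add hσ hd using 1
    ring
  · exact ⟨δ, n + w, hδ2, by linear_combination hw, hσ⟩

/-- The integral equation with `a` and `b` odd has only the trivial solutions. -/
lemma sq_eq_sq_of_odd (h : IsDescentRoot σ) {a b y : ℤ} (hab : IsCoprime a b) (ha : ¬ 2 ∣ a)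
    (hb : ¬ 2 ∣ b) (hy : y ^ 2 = (b ^ 4 - a ^ 4) ^ 3 + 4 * (b ^ 4 - a ^ 4) ^ 2 * (a * b) ^ 2
      + 16 * ((a * b) ^ 2) ^ 3) : b ^ 2 = a ^ 2 := by
  by_contra hne
  have hsub : b ^ 2 - a ^ 2 ≠ 0 := sub_ne_zero.2 hne
  obtain ⟨j, hj⟩ : 8 ∣ b ^ 2 - a ^ 2 := by
    have h₁ := Int.eight_dvd_sq_sub_one_of_odd (k := a)
      (by rwa [← Int.not_even_iff_odd, even_iff_two_dvd])
    have h₂ := Int.eight_dvd_sq_sub_one_of_odd (k := b)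
      (by rwa [← Int.not_even_iff_odd, even_iff_two_dvd])
    omega
  obtain ⟨i, hi⟩ : 2 ∣ b ^ 2 + a ^ 2 := by omega
  have hx : b ^ 4 - a ^ 4 = 16 * (j * i) := by
    linear_combination (b ^ 2 + a ^ 2) * hj + 8 * j * hi
  have hcop := isCoprime_pow_four_sub hab
  rw [hx] at hy hcop
  have hab2 : ¬ 2 ∣ a * b := fun hd => (Int.prime_two.dvd_or_dvd hd).elim ha hb
  obtain ⟨y, rfl⟩ : 4 ∣ y := (Int.pow_dvd_pow_iff two_ne_zero).1
    ⟨256 * (j * i) ^ 3 + 64 * (j * i) ^ 2 * (a * b) ^ 2 + (a * b) ^ 6, by rw [hy]; ring⟩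
  obtain ⟨γ, t, hγ, ht, ht0⟩ := h.exists_sq_of_odd hcop.of_mul_left_right hab2
    (y := y) (by linarith)
  have hxR : (b ^ 4 - a ^ 4 : R) = 16 * (j * i) := by
    have := congrArg (Int.cast : ℤ → R) hx
    push_cast at this
    exact this
  push_cast at hγ ht
  obtain ⟨g, a', b', hga, hgb, hs⟩ := exists_quarticPoint_of_sq
    (b := σ ^ 2 * (a : R) * b + σ ^ 2 * γ) (fun h0 => by
      have : σ ^ 2 * (2 * t) = 0 := by rw [← ht, ← h0]; ring
      have ht' : t ≠ 0 := fun h0 => ht0 (h0 ▸ dvd_zero σ)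
      exact mul_ne_zero (pow_ne_zero 2 h.prime.ne_zero) (mul_ne_zero h.two_ne_zero' ht') this)
    (h.translate_eq (a := (a : R)) (b := b) (γ := σ ^ 2 * γ) (by
      rw [mul_pow, hγ]
      linear_combination -(σ ^ 2 + 1) * hxR
        + (σ * (a * b) ^ 2 + (4 * σ ^ 3 - 8) * (j * i)) * h.root))
  obtain ⟨k, c, hc, hc2⟩ := exists_two_pow_mul hsub
  obtain ⟨k, rfl⟩ : ∃ l, k = l + 3 := by
    refine ⟨k - 3, ?_⟩
    have : ¬ k < 3 := fun hk => by
      interval_cases k <;> omega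
    omega
  obtain ⟨e, he⟩ := h.two_pow_eq (k + 2)
  have hcR : (b ^ 2 - a ^ 2 : R) = 2 * σ ^ 2 * (σ ^ (3 * k + 4) * (e * c)) := by
    have := congrArg (Int.cast : ℤ → R) hc
    push_cast at this
    rw [this, pow_succ', he]
    ring
  have h2σ : 2 * σ ^ 2 ≠ 0 := mul_ne_zero h.two_ne_zero' (pow_ne_zero 2 h.prime.ne_zero)
  obtain ⟨p, q, hpq⟩ := hs.1
  obtain ⟨g, rfl⟩ : 2 * σ ^ 2 ∣ g := by
    refine ⟨p * (h.eta * (σ ^ (3 * k + 4) * (e * c))) + q * t, ?_⟩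
    rw [coe_eta]
    linear_combination -g * hpq - p * hga - q * hgb + (σ ^ 2 + 1) * p * hcR + q * σ ^ 2 * ht
  have hga' : σ ^ (3 * k + 4) * (h.eta * (e * c)) = g * a' := by
    apply mul_left_cancel₀ h2σ
    rw [coe_eta]
    linear_combination hga - (σ ^ 2 + 1) * hcR
  have hgb' : t = g * b' := by
    apply mul_left_cancel₀ h2σ
    linear_combination hgb - σ ^ 2 * ht
  have hg0 : ¬ σ ∣ g := fun hd => ht0 (hgb' ▸ hd.mul_right b')
  have hb0 : ¬ σ ∣ b' := fun hd => ht0 (hgb' ▸ hd.mul_left g)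
  obtain ⟨a', rfl⟩ := h.pow_dvd_of_dvd_mul hg0 ⟨_, hga'.symm⟩
  refine h.not_quarticPoint_eta k hs (fun hd => ?_) hb0
  have : (h.eta : R) * (e * c) = g * a' := by
    apply mul_left_cancel₀ (pow_ne_zero (3 * k + 4) h.prime.ne_zero)
    linear_combination hga'
  exact h.not_dvd_mul (h.not_dvd_unit _)
    (h.not_dvd_mul (h.not_dvd_unit e) (by rwa [h.dvd_intCast_iff])) (this ▸ hd.mul_left g)

end IsDescentRoot

lemma odd_even_not_sq {a b y : ℤ} (ha : ¬ 2 ∣ a) (hb : 2 ∣ b)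
    (hy : y ^ 2 = (b ^ 4 - a ^ 4) ^ 3 + 4 * (b ^ 4 - a ^ 4) ^ 2 * (a * b) ^ 2
      + 16 * ((a * b) ^ 2) ^ 3) : False := by
  obtain ⟨k, rfl⟩ : ∃ k, a = 2 * k + 1 := ⟨a / 2, by omega⟩
  obtain ⟨b, rfl⟩ := hb
  have key : ∀ k b y : ZMod 4, y ^ 2 ≠ ((2 * b) ^ 4 - (2 * k + 1) ^ 4) ^ 3
      + 4 * ((2 * b) ^ 4 - (2 * k + 1) ^ 4) ^ 2 * ((2 * k + 1) * (2 * b)) ^ 2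
      + 16 * (((2 * k + 1) * (2 * b)) ^ 2) ^ 3 := by decide
  have := congrArg (Int.cast : ℤ → ZMod 4) hy
  push_cast at this
  exact key k b y this

namespace IsDescentRoot

variable {R : Type*} [CommRing R] [IsDomain R] [IsPrincipalIdealRing R] {σ : R}

lemma eq_zero_or_sq_eq_sq (h : IsDescentRoot σ) {a b y : ℤ} (hab : IsCoprime a b)
    (hy : y ^ 2 = (b ^ 4 - a ^ 4) ^ 3 + 4 * (b ^ 4 - a ^ 4) ^ 2 * (a * b) ^ 2
      + 16 * ((a * b) ^ 2) ^ 3) : a = 0 ∨ b ^ 2 = a ^ 2 := by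
  by_cases ha : 2 ∣ a
  · exact Or.inl (h.eq_zero_of_even hab ha hy)
  by_cases hb : 2 ∣ b
  · exact (odd_even_not_sq ha hb hy).elim
  · exact Or.inr (h.sq_eq_sq_of_odd hab ha hb hy)

lemma sq_eq_zero_or_one (h : IsDescentRoot σ) {u w : ℚ}
    (hw : w ^ 2 = -u * (u ^ 6 - 4 * u ^ 5 - 3 * u ^ 4 - 8 * u ^ 3 + 3 * u ^ 2 - 4 * u - 1)) :
    u = 0 ∨ u ^ 2 = 1 := by
  set P := u.num with hP
  obtain ⟨Q, hQ⟩ : ∃ Q : ℤ, Q = u.den := ⟨_, rfl⟩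
  have hQ0 : (0 : ℤ) < Q := by rw [hQ]; exact_mod_cast u.den_pos
  have hPQ : IsCoprime P Q := by
    rw [Int.isCoprime_iff_nat_coprime]; simpa [hP, hQ] using u.reduced
  have hu : u = P / Q := by rw [hP, hQ]; exact_mod_cast (Rat.num_div_den u).symm
  have hQne : (Q : ℚ) ≠ 0 := by exact_mod_cast hQ0.ne'
  set F := P ^ 6 - 4 * P ^ 5 * Q - 3 * P ^ 4 * Q ^ 2 - 8 * P ^ 3 * Q ^ 3 + 3 * P ^ 2 * Q ^ 4
    - 4 * P * Q ^ 5 - Q ^ 6 with hF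
  obtain ⟨W, hW⟩ : ∃ W : ℤ, W ^ 2 = -(P * Q * F) := by
    have : IsSquare (((-(P * Q * F) : ℤ)) : ℚ) := by
      refine ⟨w * Q ^ 4, ?_⟩
      have e : w * Q ^ 4 * (w * Q ^ 4) = w ^ 2 * Q ^ 8 := by ring
      rw [e, hw, hu, hF]
      push_cast
      field_simp
    obtain ⟨W, hW⟩ := Rat.isSquare_intCast_iff.1 this
    exact ⟨W, by rw [hW]; ring⟩
  have hPF : IsCoprime P F := by
    have : IsCoprime P (-Q ^ 6) := hPQ.pow_right.neg_right
    rw [show F = -Q ^ 6 + P * (P ^ 5 - 4 * P ^ 4 * Q - 3 * P ^ 3 * Q ^ 2 - 8 * P ^ 2 * Q ^ 3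
      + 3 * P * Q ^ 4 - 4 * Q ^ 5) by rw [hF]; ring]
    exact this.add_mul_left_right _
  have hQF : IsCoprime Q F := by
    have : IsCoprime Q (P ^ 6) := hPQ.symm.pow_right
    rw [show F = P ^ 6 + Q * (-4 * P ^ 5 - 3 * P ^ 4 * Q - 8 * P ^ 3 * Q ^ 2
      + 3 * P ^ 2 * Q ^ 3 - 4 * P * Q ^ 4 - Q ^ 5) by rw [hF]; ring]
    exact this.add_mul_left_right _
  obtain ⟨a, ha⟩ := Int.sq_of_isCoprime (hPQ.mul_right hPF).neg_right
    (show P * -(Q * F) = W ^ 2 by rw [hW]; ring)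
  obtain ⟨b, hb⟩ := Int.sq_of_isCoprime (hPQ.symm.mul_right hQF).neg_right
    (show Q * -(P * F) = W ^ 2 by rw [hW]; ring)
  replace hb : Q = b ^ 2 := hb.resolve_right (by nlinarith [sq_nonneg b])
  by_cases hP0 : P = 0
  · left; rw [hu, hP0]; simp
  right
  have ha0 : a ≠ 0 := by rintro rfl; simp at ha; exact hP0 ha
  have hb0 : b ≠ 0 := by rintro rfl; simp at hb; omega
  have hab0 : (a * b) ^ 2 ≠ 0 := pow_ne_zero 2 (mul_ne_zero ha0 hb0)
  have hab : IsCoprime a b := by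
    rw [hb] at hPQ
    rcases ha with ha | ha <;> rw [ha] at hPQ
    · exact (IsCoprime.pow_iff two_pos two_pos).1 hPQ
    · exact (IsCoprime.pow_iff two_pos two_pos).1 (IsCoprime.neg_left_iff _ _ |>.1 hPQ)
  have hsq : a ^ 2 = b ^ 2 := by
    rcases ha with ha | ha
    · obtain ⟨y, rfl⟩ : a * b ∣ W := (Int.pow_dvd_pow_iff two_ne_zero).1
        ⟨-F, by rw [hW, ha, hb]; ring⟩
      refine ((h.eq_zero_or_sq_eq_sq (y := y) hab (mul_left_cancel₀ hab0 ?_)).resolve_left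
        ha0).symm
      rw [hF, ha, hb] at hW
      linear_combination hW
    · obtain ⟨y, rfl⟩ : a * b ∣ W := (Int.pow_dvd_pow_iff two_ne_zero).1
        ⟨F, by rw [hW, ha, hb]; ring⟩
      refine (h.eq_zero_or_sq_eq_sq (y := y) hab.symm (mul_left_cancel₀ hab0 ?_)).resolve_left
        hb0
      rw [hF, ha, hb] at hW
      linear_combination hW
  have hbQ : (b : ℚ) ≠ 0 := by exact_mod_cast hb0
  have hsqQ : (a : ℚ) ^ 2 = b ^ 2 := by exact_mod_cast hsq
  rw [hu, hb]
  rcases ha with ha | ha <;> rw [ha] <;> push_cast <;> rw [hsqQ] <;> field_simp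

lemma rational_points (h : IsDescentRoot σ) (u w : ℚ) :
    w ^ 2 = -u * (u ^ 6 - 4 * u ^ 5 - 3 * u ^ 4 - 8 * u ^ 3 + 3 * u ^ 2 - 4 * u - 1) ↔
      ((u, w) = (0, 0) ∨ (u, w) = (1, 4) ∨ (u, w) = (1, -4) ∨ (u, w) = (-1, 4) ∨
        (u, w) = (-1, -4)) := by
  simp only [Prod.mk.injEq]
  constructor
  · intro hw
    have h16 : w ^ 2 = 16 → w = 4 ∨ w = -4 := fun e =>
      sq_eq_sq_iff_eq_or_eq_neg.1 (by rw [e]; norm_num)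
    rcases h.sq_eq_zero_or_one hw with rfl | hu
    · left; simpa using hw
    · rcases sq_eq_sq_iff_eq_or_eq_neg.1 (hu.trans (one_pow 2).symm) with rfl | rfl
      · rcases h16 (by rw [hw]; norm_num) with rfl | rfl <;> simp
      · rcases h16 (by rw [hw]; norm_num) with rfl | rfl <;> simp
  · rintro (⟨rfl, rfl⟩ | ⟨rfl, rfl⟩ | ⟨rfl, rfl⟩ | ⟨rfl, rfl⟩ | ⟨rfl, rfl⟩) <;> norm_num

end IsDescentRoot

section EtaNotSquare

variable {R : Type*} [CommRing R] [IsDomain R] {σ : R}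

lemma eta_ne_sq (root : σ ^ 3 + 2 * σ ^ 2 + 2 = 0) (prime : Prime σ)
    (residue : ∀ x : R, σ ∣ x ∨ σ ∣ x - 1) (v : R) : σ ^ 2 + 1 ≠ v ^ 2 := by
  intro hv
  have h0 := prime.ne_zero
  have h1 := prime.not_dvd_one
  have h2 : (2 : R) = σ ^ 3 * (σ ^ 2 + 2 * σ - 1) := by linear_combination (1 - σ ^ 2) * root
  set c := σ ^ 2 + 2 * σ - 1 with hc
  rcases residue v with ⟨t, ht⟩ | ⟨t, ht⟩
  · exact h1 ⟨v * t - σ, by linear_combination hv + v * ht⟩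
  obtain rfl : v = 1 + σ * t := by linear_combination ht
  have ht : σ ^ 2 * c * t = 1 - t ^ 2 := by
    apply mul_left_cancel₀ (pow_ne_zero 2 h0)
    linear_combination -hv - σ * t * h2
  rcases residue t with ⟨s, rfl⟩ | ⟨s, hs⟩
  · exact h1 ⟨σ ^ 2 * c * s + σ * s ^ 2, by linear_combination -ht⟩
  obtain rfl : t = 1 + σ * s := by linear_combination hs
  have hs : c * (1 + σ * s) = -(σ ^ 2 * c * s + s ^ 2) := by
    apply mul_left_cancel₀ (pow_ne_zero 2 h0)
    linear_combination ht - σ * s * h2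
  rcases residue s with ⟨r, rfl⟩ | ⟨r, hr⟩
  · exact h1 ⟨σ + 2 + c * σ * r + σ ^ 2 * c * r + σ * r ^ 2, by linear_combination hc - hs⟩
  obtain rfl : s = 1 + σ * r := by linear_combination hr
  refine h1 ⟨-r + σ ^ 2 * c * (1 + σ * (1 + σ * r) + r) + (1 + σ * (1 + σ * r))
    + c * (1 + σ * r) + r ^ 2, mul_left_cancel₀ h0 ?_⟩
  linear_combination -hs + (1 + σ * (1 + σ * r)) * hc
    + σ * (1 + σ * (1 + σ * r) + r) * h2

lemma eta_ne_neg_sq (root : σ ^ 3 + 2 * σ ^ 2 + 2 = 0) (prime : Prime σ)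
    (residue : ∀ x : R, σ ∣ x ∨ σ ∣ x - 1) (v : R) : σ ^ 2 + 1 ≠ -v ^ 2 := by
  intro hv
  have h0 := prime.ne_zero
  have h1 := prime.not_dvd_one
  have h2 : (2 : R) = σ ^ 3 * (σ ^ 2 + 2 * σ - 1) := by linear_combination (1 - σ ^ 2) * root
  set c := σ ^ 2 + 2 * σ - 1 with hc
  rcases residue v with ⟨t, ht⟩ | ⟨t, ht⟩
  · exact h1 ⟨-v * t - σ, by linear_combination hv - v * ht⟩
  obtain rfl : v = 1 + σ * t := by linear_combination ht
  have ht : σ * c + σ ^ 2 * c * t + 1 + t ^ 2 = 0 := by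
    apply mul_left_cancel₀ (pow_ne_zero 2 h0)
    linear_combination hv - h2 - σ * t * h2
  rcases residue t with ⟨s, rfl⟩ | ⟨s, hs⟩
  · exact h1 ⟨-(c + σ ^ 2 * c * s + σ * s ^ 2), by linear_combination ht⟩
  obtain rfl : t = 1 + σ * s := by linear_combination hs
  have hs : c * (1 + σ + σ ^ 2 * s + σ ^ 2 + σ ^ 3 * s) = - σ * s ^ 2 := by
    apply mul_left_cancel₀ h0
    linear_combination ht - (1 + σ * s) * h2
  exact h1 ⟨σ + 2 + c * (1 + σ * s + σ + σ ^ 2 * s) + s ^ 2, by linear_combination hc - hs⟩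

end EtaNotSquare

open Polynomial NumberField

/-- The cubic `X³ + 2X² + 2` over the integers. -/
noncomputable def descentPoly : ℤ[X] := X ^ 3 + 2 * X ^ 2 + 2

lemma natDegree_descentPoly : descentPoly.natDegree = 3 := by
  unfold descentPoly; compute_degree!

lemma monic_descentPoly : descentPoly.Monic := by
  unfold descentPoly; monicity!

lemma root_of_eval₂_eq_zero {L : Type*} [CommRing L] (φ : ℚ →+* L) (x : L)
    (h : (descentPoly.map (algebraMap ℤ ℚ)).eval₂ φ x = 0) : x ^ 3 + 2 * x ^ 2 + 2 = 0 := by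
  rw [eval₂_map] at h
  simpa only [descentPoly, eval₂_add, eval₂_mul, eval₂_pow, eval₂_X, eval₂_ofNat] using h

lemma irreducible_descentPoly : Irreducible (descentPoly.map (algebraMap ℤ ℚ)) := by
  rw [← monic_descentPoly.irreducible_iff_irreducible_map_fraction_map]
  have hc : ∀ n, descentPoly.coeff n =
      if n = 3 then 1 else if n = 2 then 2 else if n = 0 then 2 else 0 := by
    intro n
    have : descentPoly = X ^ 3 + C 2 * X ^ 2 + C 2 := by simp [descentPoly]
    rw [this]
    simp only [coeff_add, coeff_X_pow, coeff_C_mul, coeff_C]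
    split_ifs <;> simp_all
  refine IsEisensteinAt.irreducible (𝓟 := Ideal.span {2}) ⟨?_, ?_, ?_⟩
    ((Ideal.span_singleton_prime two_ne_zero).2 Int.prime_two) monic_descentPoly.isPrimitive
    (by rw [natDegree_descentPoly]; norm_num)
  · rw [monic_descentPoly.leadingCoeff, Ideal.mem_span_singleton]; norm_num
  · intro n hn
    rw [natDegree_descentPoly] at hn
    rw [hc, Ideal.mem_span_singleton]
    split_ifs <;> omega
  · rw [hc, Ideal.span_singleton_pow, Ideal.mem_span_singleton]; norm_num

instance : Fact (Irreducible (descentPoly.map (algebraMap ℤ ℚ))) := ⟨irreducible_descentPoly⟩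

/-- The cubic field generated by a root of `X³ + 2X² + 2`. -/
noncomputable abbrev DescentField : Type := AdjoinRoot (descentPoly.map (algebraMap ℤ ℚ))

namespace DescentField

instance : NumberField DescentField where
  to_charZero := charZero_of_injective_algebraMap (algebraMap ℚ DescentField).injective
  to_finiteDimensional :=
    (AdjoinRoot.powerBasis irreducible_descentPoly.ne_zero).finite

/-- The generator of the field. -/
noncomputable def gen : DescentField := AdjoinRoot.root _

lemma gen_root : gen ^ 3 + 2 * gen ^ 2 + 2 = 0 :=
  root_of_eval₂_eq_zero _ _ (AdjoinRoot.eval₂_root _)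

lemma natDegree_map : (descentPoly.map (algebraMap ℤ ℚ)).natDegree = 3 := by
  rw [monic_descentPoly.natDegree_map, natDegree_descentPoly]

/-- The basis `1, σ, σ²`. -/
noncomputable def basis : Module.Basis (Fin 3) ℚ DescentField :=
  (AdjoinRoot.powerBasis irreducible_descentPoly.ne_zero).basis.reindex
    (finCongr (by rw [AdjoinRoot.powerBasis_dim, natDegree_map]))

lemma basis_apply (i : Fin 3) : basis i = gen ^ (i : ℕ) := by
  simp [basis, gen]

lemma finrank_eq : Module.finrank ℚ DescentField = 3 := by
  simpa using Module.finrank_eq_card_basis basis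

lemma leftMulMatrix_gen :
    Algebra.leftMulMatrix basis gen = !![0, 0, -2; 1, 0, 0; 0, 1, -2] := by
  have h3 : gen * gen ^ 2 = -(2 : ℚ) • basis 0 + -(2 : ℚ) • basis 2 := by
    simp only [basis_apply, Algebra.smul_def, map_neg, map_ofNat]
    norm_num
    linear_combination gen_root
  have h0 : gen * basis 0 = basis 1 := by simp [basis_apply]
  have h1 : gen * basis 1 = basis 2 := by simp [basis_apply]; ring
  have h2 : gen * basis 2 = -(2 : ℚ) • basis 0 + -(2 : ℚ) • basis 2 := by
    rw [← h3, basis_apply]; rfl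
  ext i j
  rw [Algebra.leftMulMatrix_eq_repr_mul]
  fin_cases j
  · fin_cases i <;> simp [h0]
  · fin_cases i <;> simp [h1]
  · fin_cases i <;> simp [h2]

/-- The generator as an algebraic integer. -/
noncomputable def sigma : 𝓞 DescentField := ⟨gen, descentPoly, monic_descentPoly, by
  simpa [descentPoly] using gen_root⟩

lemma coe_sigma : (sigma : DescentField) = gen := rfl

lemma sigma_root : sigma ^ 3 + 2 * sigma ^ 2 + 2 = 0 := by
  apply RingOfIntegers.coe_injective
  simpa only [map_add, map_mul, map_pow, map_ofNat, map_zero, coe_sigma] using! gen_root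

lemma norm_sigma : Algebra.norm ℤ sigma = -2 := by
  have : (Algebra.norm ℤ sigma : ℚ) = -2 := by
    rw [Algebra.coe_norm_int, coe_sigma, Algebra.norm_eq_matrix_det basis, leftMulMatrix_gen]
    simp [Matrix.det_fin_three]
  exact_mod_cast this

lemma norm_sigma_add_one : Algebra.norm ℤ (sigma + 1) = -3 := by
  have : (Algebra.norm ℤ (sigma + 1) : ℚ) = -3 := by
    rw [Algebra.coe_norm_int, Algebra.norm_eq_matrix_det basis]
    simp [coe_sigma, leftMulMatrix_gen, Matrix.det_fin_three]
    norm_num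
  exact_mod_cast this

lemma trace_sigma_pow (n : ℕ) : Algebra.trace ℤ (𝓞 DescentField) (sigma ^ n) =
    (!![0, 0, -2; 1, 0, 0; 0, 1, -2] ^ n : Matrix (Fin 3) (Fin 3) ℤ).trace := by
  rw [← Int.cast_inj (α := ℚ), Algebra.coe_trace_int, Algebra.trace_eq_matrix_trace basis,
    show ((sigma ^ n : 𝓞 DescentField) : DescentField) = gen ^ n from
      map_pow (algebraMap (𝓞 DescentField) DescentField) sigma n, map_pow,
    leftMulMatrix_gen, ← eq_intCast (Int.castRingHom ℚ),
    AddMonoidHom.map_trace, ← RingHom.mapMatrix_apply, map_pow]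
  congr 2
  ext i j
  fin_cases i <;> fin_cases j <;> simp

lemma discr_sigma_pow : Algebra.discr ℤ (fun i : Fin 3 => sigma ^ (i : ℕ)) = -172 := by
  rw [Algebra.discr_def, Matrix.det_fin_three]
  simp only [Algebra.traceMatrix_apply, Algebra.traceForm_apply, ← pow_add, trace_sigma_pow]
  decide

lemma exists_sq_mul_discr : ∃ n : ℤ, n ^ 2 * discr DescentField = -172 := by
  let b : Module.Basis (Fin 3) ℤ (𝓞 DescentField) := Module.finBasisOfFinrankEq ℤ (𝓞 DescentField)
    ((RingOfIntegers.rank DescentField).trans finrank_eq)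
  refine ⟨(b.toMatrix fun i : Fin 3 => sigma ^ (i : ℕ)).det, ?_⟩
  rw [← discr_eq_discr DescentField b, ← Algebra.discr_of_matrix_vecMul, ← discr_sigma_pow]
  congr 1
  exact Module.Basis.toMatrix_map_vecMul b _

lemma discr_neg : discr DescentField < 0 := by
  obtain ⟨n, hn⟩ := exists_sq_mul_discr
  nlinarith [sq_nonneg n]

lemma abs_discr_le : |discr DescentField| ≤ 172 := by
  obtain ⟨n, hn⟩ := exists_sq_mul_discr
  rw [abs_of_neg discr_neg]
  have : 0 < n ^ 2 := by
    rcases (sq_nonneg n).eq_or_lt with h | h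
    · rw [← h] at hn; norm_num at hn
    · exact h
  nlinarith [discr_neg]

lemma nrComplexPlaces_eq : InfinitePlace.nrComplexPlaces DescentField = 1 := by
  have h := InfinitePlace.card_add_two_mul_card_eq_rank DescentField
  have hs := sign_discr DescentField
  rw [finrank_eq] at h
  rw [Int.sign_eq_neg_one_of_neg discr_neg] at hs
  have : InfinitePlace.nrComplexPlaces DescentField ≠ 0 := by
    intro h0
    simp [h0] at hs
  omega

lemma rank_eq : Units.rank DescentField = 1 := by
  have h := InfinitePlace.card_add_two_mul_card_eq_rank DescentField
  rw [finrank_eq, nrComplexPlaces_eq] at h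
  rw [Units.rank, InfinitePlace.card_eq_nrRealPlaces_add_nrComplexPlaces, nrComplexPlaces_eq]
  omega

lemma absNorm_span_sigma : Ideal.absNorm (Ideal.span {sigma}) = 2 := by
  simp [Ideal.absNorm_span_singleton, norm_sigma]

lemma absNorm_span_sigma_add_one : Ideal.absNorm (Ideal.span {sigma + 1}) = 3 := by
  simp [Ideal.absNorm_span_singleton, norm_sigma_add_one]

lemma prime_sigma : Prime sigma := by
  refine Ideal.prime_of_irreducible_absNorm_span ?_ ?_
  · intro h
    have := norm_sigma
    rw [h] at this
    simp at this
  · rw [absNorm_span_sigma]; exact Nat.prime_two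

lemma sigma_residue (x : 𝓞 DescentField) : sigma ∣ x ∨ sigma ∣ x - 1 := by
  have hcard : Nat.card (𝓞 DescentField ⧸ Ideal.span {sigma}) = 2 := absNorm_span_sigma
  have h01 : (1 : 𝓞 DescentField ⧸ Ideal.span {sigma}) ≠ 0 := by
    rw [← map_one (Ideal.Quotient.mk _), Ne, Ideal.Quotient.eq_zero_iff_dvd]
    exact prime_sigma.not_dvd_one
  obtain ⟨a, b, hab, huniv⟩ := Nat.card_eq_two_iff.1 hcard
  have hmem : ∀ y : 𝓞 DescentField ⧸ Ideal.span {sigma}, y = a ∨ y = b := fun y => by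
    have : y ∈ ({a, b} : Set _) := huniv ▸ Set.mem_univ y
    simpa using this
  have key : ∀ y : 𝓞 DescentField ⧸ Ideal.span {sigma}, y = 0 ∨ y = 1 := fun y => by
    have := hmem y; have := hmem 0; have := hmem 1
    grind
  rw [← Ideal.Quotient.eq_zero_iff_dvd, ← Ideal.Quotient.eq_zero_iff_dvd, map_sub, map_one,
    sub_eq_zero]
  exact key _

lemma minkowski_lt_four : (4 / Real.pi) ^ InfinitePlace.nrComplexPlaces DescentField *
    ((Module.finrank ℚ DescentField).factorial /
        (Module.finrank ℚ DescentField) ^ (Module.finrank ℚ DescentField) *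
      √|discr DescentField|) < 4 := by
  have hd : √|(discr DescentField : ℝ)| ≤ 13.12 := by
    rw [Real.sqrt_le_left (by norm_num)]
    have : |(discr DescentField : ℝ)| ≤ 172 := by exact_mod_cast abs_discr_le
    linarith
  have hpi : 4 / Real.pi ≤ 1.274 := by
    rw [div_le_iff₀ Real.pi_pos]
    nlinarith [Real.pi_gt_d2]
  rw [nrComplexPlaces_eq, finrank_eq, pow_one]
  norm_num [Nat.factorial] at hd hpi ⊢
  have := Real.sqrt_nonneg |(discr DescentField : ℝ)|
  have h4 : 0 < 4 / Real.pi := by positivity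
  nlinarith

lemma span_eq_of_mem {I : Ideal (𝓞 DescentField)} {x : 𝓞 DescentField} (hx : x ∈ I)
    (hI : Ideal.absNorm I = Ideal.absNorm (Ideal.span {x})) (h0 : Ideal.absNorm I ≠ 0) :
    I = Ideal.span {x} := by
  have hle : Ideal.span {x} ≤ I := (Ideal.span_singleton_le_iff_mem I).2 hx
  obtain ⟨J, hJ⟩ := Ideal.dvd_iff_le.2 hle
  have : Ideal.absNorm J = 1 := by
    rw [hJ, map_mul] at hI
    exact Nat.eq_of_mul_eq_mul_left (Nat.pos_of_ne_zero h0) (by omega)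
  rw [Ideal.absNorm_eq_one_iff] at this
  rw [hJ, this, Ideal.mul_top]

instance : IsPrincipalIdealRing (𝓞 DescentField) := by
  refine RingOfIntegers.isPrincipalIdealRing_of_isPrincipal_of_norm_le_of_isPrime ?_
  rintro ⟨I, hI0⟩ hI hle
  have hlt : Ideal.absNorm I < 4 := by exact_mod_cast hle.trans_lt minkowski_lt_four
  have h0 : Ideal.absNorm I ≠ 0 := Ideal.absNorm_ne_zero_of_nonZeroDivisors ⟨I, hI0⟩
  have h1 : Ideal.absNorm I ≠ 1 := by
    rw [Ne, Ideal.absNorm_eq_one_iff]; exact hI.ne_top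
  have hm := Ideal.absNorm_mem I
  have hI' : I.IsPrime := hI
  have h23 : Ideal.absNorm I = 2 ∨ Ideal.absNorm I = 3 := by omega
  rcases h23 with h | h
  · rw [h] at hm
    have : sigma ∈ I := hI'.mem_of_pow_mem 3 (by
      rw [show sigma ^ 3 = -(sigma ^ 2 + 1) * ((2 : ℕ) : 𝓞 DescentField) by
        push_cast; linear_combination sigma_root]
      exact I.mul_mem_left _ hm)
    exact ⟨⟨sigma, span_eq_of_mem this (by rw [h, absNorm_span_sigma]) h0⟩⟩
  · rw [h] at hm
    have hprod : (sigma + 1) * (sigma ^ 2 + sigma - 1) ∈ I := by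
      rw [show (sigma + 1) * (sigma ^ 2 + sigma - 1) = -1 * ((3 : ℕ) : 𝓞 DescentField) by
        push_cast; linear_combination sigma_root]
      exact I.mul_mem_left _ hm
    have : sigma + 1 ∈ I := by
      refine (hI'.mem_or_mem hprod).resolve_right fun hq => ?_
      have hmax := hI'.isMaximal (nonZeroDivisors.ne_zero hI0)
      let := Ideal.Quotient.field I
      have hcard : Nat.card (𝓞 DescentField ⧸ I) = 3 := h
      have : Finite (𝓞 DescentField ⧸ I) := Nat.finite_of_card_ne_zero (by rw [hcard]; decide)
      let := Fintype.ofFinite (𝓞 DescentField ⧸ I)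
      have hpow := FiniteField.pow_card (Ideal.Quotient.mk I sigma)
      rw [← Nat.card_eq_fintype_card, hcard, ← map_pow, Ideal.Quotient.eq] at hpow
      refine hI'.ne_top ((Ideal.eq_top_iff_one I).2 ?_)
      have hcomb := I.sub_mem (I.mul_mem_left (sigma ^ 2 + sigma - 1) hq)
        (I.mul_mem_left (sigma + 2) hpow)
      convert hcomb using 1
      ring
    exact ⟨⟨sigma + 1, span_eq_of_mem this (by rw [h, absNorm_span_sigma_add_one]) h0⟩⟩

lemma isDescentRoot_sigma : IsDescentRoot sigma where
  root := sigma_root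
  prime := prime_sigma
  residue := sigma_residue
  units := by
    have hodd : Odd (Module.finrank ℚ DescentField) := by rw [finrank_eq]; decide
    let f : (𝓞 DescentField)ˣ := Units.fundSystem DescentField ⟨0, by rw [rank_eq]; exact one_pos⟩
    have hsub : Subsingleton (Fin (Units.rank DescentField)) := by rw [rank_eq]; infer_instance
    have hpow : ∀ e : (𝓞 DescentField)ˣ, ∃ k : ℤ, e = f ^ k ∨ e = -f ^ k := fun e => by
      obtain ⟨⟨ζ, k⟩, hk, -⟩ := Units.exist_unique_eq_mul_prod DescentField e
      refine ⟨k ⟨0, by rw [rank_eq]; exact one_pos⟩, ?_⟩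
      rw [Fintype.prod_subsingleton _ ⟨0, by rw [rank_eq]; exact one_pos⟩] at hk
      rcases Units.torsion_eq_one_or_neg_one_of_odd_finrank hodd ζ with h | h
      · left; simpa [h] using hk
      · right; simpa [h] using hk
    have hη : ∃ η : (𝓞 DescentField)ˣ, (η : 𝓞 DescentField) = sigma ^ 2 + 1 :=
      ⟨⟨sigma ^ 2 + 1, 1 - 2 * sigma - sigma ^ 2, by linear_combination (-sigma) * sigma_root,
        by linear_combination (-sigma) * sigma_root⟩, rfl⟩
    obtain ⟨η, hη⟩ := hη
    have hsq : ∀ v : (𝓞 DescentField)ˣ, η ≠ v ^ 2 ∧ η ≠ -v ^ 2 := fun v => by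
      refine ⟨fun h => eta_ne_sq sigma_root prime_sigma sigma_residue v ?_,
        fun h => eta_ne_neg_sq sigma_root prime_sigma sigma_residue v ?_⟩
      · rw [← hη, h]; simp
      · rw [← hη, h]; simp
    obtain ⟨k, hk⟩ := hpow η
    have hkodd : Odd k := by
      rw [← Int.not_even_iff_odd]
      rintro ⟨m, rfl⟩
      rw [← two_mul, mul_comm, zpow_mul] at hk
      rcases hk with hk | hk
      · exact (hsq (f ^ m)).1 (by exact_mod_cast hk)
      · exact (hsq (f ^ m)).2 (by exact_mod_cast hk)
    intro e
    rw [← hη]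
    suffices ∃ v : (𝓞 DescentField)ˣ, e = v ^ 2 ∨ e = -v ^ 2 ∨ e = η * v ^ 2 ∨ e = -(η * v ^ 2) by
      obtain ⟨v, hv⟩ := this
      exact ⟨v, by simpa [Units.ext_iff] using hv⟩
    obtain ⟨l, hl⟩ := hpow e
    rcases Int.even_or_odd l with ⟨m, rfl⟩ | hlodd
    · refine ⟨f ^ m, ?_⟩
      rw [zpow_add, ← sq] at hl
      tauto
    · obtain ⟨m, hm⟩ := hlodd.sub_odd hkodd
      refine ⟨f ^ m, ?_⟩
      have : f ^ l = f ^ k * (f ^ m) ^ 2 := by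
        rw [sq, ← zpow_add, ← zpow_add, ← hm]; congr 1; ring
      rw [this] at hl
      rcases hk with hk | hk <;> rcases hl with hl | hl <;> simp [hk, hl]

end DescentField

theorem rational_points_C3 (u w : ℚ) :
    w ^ 2 = -u * (u ^ 6 - 4 * u ^ 5 - 3 * u ^ 4 - 8 * u ^ 3 + 3 * u ^ 2 - 4 * u - 1) ↔
      ((u, w) = (0, 0) ∨ (u, w) = (1, 4) ∨ (u, w) = (1, -4) ∨
        (u, w) = (-1, 4) ∨ (u, w) = (-1, -4)) :=
  DescentField.isDescentRoot_sigma.rational_points u w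
end

section
/- The only pairs (T,U) ∈ ℚ × ℚ satisfying −(T² + 2T + 8)U² = (U² + U + 4)(U − 4) are (0,−4) and (−2,−4). -/
open Polynomial NumberField

/-- A nonzero element of a unique factorization domain is a squarefree element times a square. -/
theorem exists_squarefree_mul_sq {R : Type*} [CommRing R] [IsDomain R]
    [UniqueFactorizationMonoid R] (x : R) (hx : x ≠ 0) :
    ∃ s t : R, Squarefree s ∧ x = s * t ^ 2 := by
  induction x using UniqueFactorizationMonoid.induction_on_prime with
  | h₁ => exact absurd rfl hx
  | h₂ x h => exact ⟨x, 1, h.squarefree, by ring⟩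
  | h₃ a p ha hp ih =>
    obtain ⟨s, t, hs, rfl⟩ := ih ha
    by_cases hps : p ∣ s
    · obtain ⟨k, rfl⟩ := hps
      exact ⟨k, p * t, hs.of_mul_right, by ring⟩
    · refine ⟨p * s, t, ?_, by ring⟩
      rw [squarefree_mul_iff]
      exact ⟨hp.irreducible.isRelPrime_iff_not_dvd.2 hps, hp.irreducible.squarefree, hs⟩

/-- If `x * y` is a square then `x` is a square up to a squarefree common divisor of
`x` and `y`. -/
theorem exists_squarefree_dvd_of_mul_eq_sq {R : Type*} [CommRing R] [IsDomain R]
    [UniqueFactorizationMonoid R] {x y z : R} (hx : x ≠ 0) (h : x * y = z ^ 2) :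
    ∃ s t : R, Squarefree s ∧ x = s * t ^ 2 ∧ s ∣ y := by
  obtain ⟨s, t, hs, rfl⟩ := exists_squarefree_mul_sq x hx
  refine ⟨s, t, hs, rfl, ?_⟩
  have ht : t ≠ 0 := by rintro rfl; simp at hx
  have hs0 : s ≠ 0 := by rintro rfl; simp at hx
  obtain ⟨k, rfl⟩ : t ∣ z := (IsIntegrallyClosed.pow_dvd_pow_iff two_ne_zero).1
    ⟨s * y, by rw [← h]; ring⟩
  have hk : s * y = k ^ 2 := mul_left_cancel₀ (pow_ne_zero 2 ht) (by linear_combination h)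
  obtain ⟨l, rfl⟩ := (hs.dvd_pow_iff_dvd two_ne_zero).1 ⟨y, hk.symm⟩
  exact ⟨l ^ 2, mul_left_cancel₀ hs0 (by linear_combination hk)⟩

theorem sq_add_sq_obstruction (n : ℕ) : ∀ s q r d : ℤ, r.natAbs = n → s ^ 2 + q ^ 2 = 2 * r ^ 2 →
    d ^ 2 = (s - q) ^ 2 + 2 * q ^ 2 + 4 * q * r → d = 0 := by
  induction n using Nat.strong_induction_on with
  | _ n ih =>
    intro s q r d hn h1 h2
    rcases Int.even_or_odd' s with ⟨s', rfl | rfl⟩ <;>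
      rcases Int.even_or_odd' q with ⟨q', rfl | rfl⟩
    · have hr : Even r := by
        have : Even (r ^ 2) := ⟨s' ^ 2 + q' ^ 2, by linarith⟩
        exact (Int.even_pow.1 this).1
      obtain ⟨r', rfl⟩ := hr
      have hd : Even d := by
        have : Even (d ^ 2) := ⟨2 * (s' - q') ^ 2 + 4 * q' ^ 2 + 8 * q' * r', by rw [h2]; ring⟩
        exact (Int.even_pow.1 this).1
      obtain ⟨d', rfl⟩ := hd
      by_cases hr0 : r' = 0
      · subst hr0
        have hs : s' = 0 := by nlinarith [sq_nonneg s', sq_nonneg q']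
        have hq : q' = 0 := by nlinarith [sq_nonneg s', sq_nonneg q']
        subst hs hq
        simpa using h2
      · have := ih r'.natAbs (by omega) s' q' r' d' rfl (by linarith) (by linarith)
        rw [this]; rfl
    · exfalso; ring_nf at h1; omega
    · exfalso; ring_nf at h1; omega
    · exfalso
      rcases Int.even_or_odd' d with ⟨d', rfl | rfl⟩ <;> ring_nf at h2 <;> omega

theorem rat_obstruction (s q r d : ℚ) (h1 : s ^ 2 + q ^ 2 = 2 * r ^ 2)
    (h2 : d ^ 2 = (s - q) ^ 2 + 2 * q ^ 2 + 4 * q * r) : d = 0 := by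
  obtain ⟨N, hN⟩ := IsLocalization.exist_integer_multiples_of_finset (nonZeroDivisors ℤ)
    ({s, q, r, d} : Finset ℚ)
  have hN0 : ((N : ℤ) : ℚ) ≠ 0 := by simp
  have key (x : ℚ) (hx : x ∈ ({s, q, r, d} : Finset ℚ)) : ∃ k : ℤ, (k : ℚ) = (N : ℤ) * x := by
    obtain ⟨k, hk⟩ := hN x hx
    exact ⟨k, by simpa [Submonoid.smul_def] using hk⟩
  obtain ⟨s', hs⟩ := key s (by simp)
  obtain ⟨q', hq⟩ := key q (by simp)
  obtain ⟨r', hr⟩ := key r (by simp)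
  obtain ⟨d', hd⟩ := key d (by simp)
  have := sq_add_sq_obstruction _ s' q' r' d' rfl
    (by qify; rw [hs, hq, hr]; linear_combination ((N : ℤ) : ℚ) ^ 2 * h1)
    (by qify; rw [hs, hq, hr, hd]; linear_combination ((N : ℤ) : ℚ) ^ 2 * h2)
  rw [this] at hd
  simpa [hN0] using hd.symm

/-- A rational point of `y ^ 2 = 4 x ^ 3 - 4 x ^ 2 + 1` has an abscissa whose denominator is a
square. -/
theorem exists_integral_coords {x y : ℚ} (h : y ^ 2 = 4 * x ^ 3 - 4 * x ^ 2 + 1) :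
    ∃ d b : ℤ, 0 < d ∧ (x.den : ℤ) = d ^ 2 ∧
      b ^ 2 = 4 * x.num ^ 3 - 4 * x.num ^ 2 * d ^ 2 + d ^ 6 := by
  obtain ⟨Y, rfl⟩ : ∃ Y, y = 2 * Y + 1 := ⟨(y - 1) / 2, by ring⟩
  have hx := x.num_div_den
  have hY := Y.num_div_den
  have hxc : IsCoprime x.num (x.den : ℤ) := Rat.isCoprime_num_den x
  have hYc : IsCoprime Y.num (Y.den : ℤ) := Rat.isCoprime_num_den Y
  have hx0 : (0 : ℤ) < x.den := by exact_mod_cast x.den_pos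
  have hY0 : (0 : ℤ) < Y.den := by exact_mod_cast Y.den_pos
  have hxq : (x.den : ℚ) ≠ 0 := by exact_mod_cast x.den_ne_zero
  have hYq : (Y.den : ℚ) ≠ 0 := by exact_mod_cast Y.den_ne_zero
  have heq : Y.num * (Y.num + Y.den) * (x.den : ℤ) ^ 3 =
      x.num ^ 2 * (x.num - x.den) * (Y.den : ℤ) ^ 2 := by
    rw [← hx, ← hY] at h
    field_simp at h
    qify
    linear_combination h / 4
  generalize x.num = a at *
  generalize (x.den : ℤ) = e at *
  generalize Y.num = n at *
  generalize (Y.den : ℤ) = m at *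
  have hm : m ^ 2 ∣ e ^ 3 := by
    have : IsCoprime (m ^ 2) (n * (n + m)) := by
      apply IsCoprime.pow_left
      apply IsCoprime.mul_right hYc.symm
      simpa using hYc.symm.add_mul_left_right 1
    exact this.dvd_of_dvd_mul_left ⟨_, by rw [heq, mul_comm]⟩
  have he : e ^ 3 ∣ m ^ 2 := by
    have : IsCoprime (e ^ 3) (a ^ 2 * (a - e)) := by
      apply IsCoprime.pow_left
      apply IsCoprime.mul_right hxc.symm.pow_right
      simpa [sub_eq_add_neg] using hxc.symm.add_mul_left_right (-1)
    exact this.dvd_of_dvd_mul_left ⟨_, by rw [← heq, mul_comm]⟩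
  have hme : m ^ 2 = e ^ 3 := Int.dvd_antisymm (by positivity) (by positivity) hm he
  obtain ⟨k, rfl⟩ : e ∣ m := (Int.pow_dvd_pow_iff two_ne_zero).1 ⟨e, by rw [hme]; ring⟩
  have hk : e = k ^ 2 := by
    have : e ^ 2 * (e - k ^ 2) = 0 := by linear_combination -hme
    have := (mul_eq_zero.1 this).resolve_left (by positivity)
    linarith
  refine ⟨k, 2 * n + e * k, pos_of_mul_pos_right hY0 hx0.le, hk, ?_⟩
  subst hk
  have : (k ^ 2) ^ 3 ≠ 0 := by positivity
  apply mul_left_cancel₀ this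
  linear_combination 4 * heq

/-- Passing from the abscissa `A / E` of a point to the abscissa `a / e` of its double increases
heights. -/
theorem height_bound {a e A E : ℤ} (hae : IsCoprime a e) (he : 0 < e) (hAE : IsCoprime A E)
    (hE : 0 < E)
    (h : a * (E * (4 * A ^ 3 - 4 * A ^ 2 * E + E ^ 3)) = e * (A ^ 4 - 2 * A * E ^ 3 + E ^ 4)) :
    max |A| E ^ 4 ≤ 139 * max |a| e := by
  obtain ⟨g, hF⟩ : e ∣ E * (4 * A ^ 3 - 4 * A ^ 2 * E + E ^ 3) :=
    hae.symm.dvd_of_dvd_mul_left ⟨_, h⟩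
  have hG : A ^ 4 - 2 * A * E ^ 3 + E ^ 4 = a * g := by
    apply mul_left_cancel₀ he.ne'
    rw [← h, hF]; ring
  have hE7 : 11 * E ^ 7 = g * (a * (-16 * E ^ 3 - 32 * A * E ^ 2 + 48 * A ^ 2 * E) +
      e * (27 * E ^ 3 - 4 * A ^ 2 * E - 12 * A ^ 3)) := by
    linear_combination (-16 * E ^ 3 - 32 * A * E ^ 2 + 48 * A ^ 2 * E) * hG +
      (27 * E ^ 3 - 4 * A ^ 2 * E - 12 * A ^ 3) * hF
  have hA7 : 11 * A ^ 7 = g * (a * (6 * E ^ 3 + 4 * A * E ^ 2 - 20 * A ^ 2 * E + 11 * A ^ 3) +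
      e * (-6 * E ^ 3 + 8 * A * E ^ 2 + 4 * A ^ 2 * E + 5 * A ^ 3)) := by
    linear_combination (6 * E ^ 3 + 4 * A * E ^ 2 - 20 * A ^ 2 * E + 11 * A ^ 3) * hG +
      (-6 * E ^ 3 + 8 * A * E ^ 2 + 4 * A ^ 2 * E + 5 * A ^ 3) * hF
  have hg : |g| ≤ 11 := by
    obtain ⟨m, n, hmn⟩ : IsCoprime (A ^ 7) (E ^ 7) := hAE.pow
    refine Int.le_of_dvd (by norm_num) ((abs_dvd _ _).2 ?_)
    have : (11 : ℤ) = m * (11 * A ^ 7) + n * (11 * E ^ 7) := by linear_combination -11 * hmn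
    rw [this, hE7, hA7]
    exact dvd_add (dvd_mul_of_dvd_right (dvd_mul_right _ _) _)
      (dvd_mul_of_dvd_right (dvd_mul_right _ _) _)
  set M := max |A| E with hM
  set H := max |a| e with hH
  have hM0 : 0 < M := lt_max_of_lt_right hE
  have hH0 : 0 < H := lt_max_of_lt_right he
  have hAM : |A| ≤ M := le_max_left _ _
  have hEM : |E| ≤ M := by rw [abs_of_pos hE]; exact le_max_right _ _
  have haH : |a| ≤ H := le_max_left _ _
  have heH : |e| ≤ H := by rw [abs_of_pos he]; exact le_max_right _ _
  have c0 : |E ^ 3| ≤ M ^ 3 := by rw [abs_pow]; gcongr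
  have c1 : |A * E ^ 2| ≤ M ^ 3 := by
    rw [abs_mul, abs_pow, pow_succ' M]; gcongr
  have c2 : |A ^ 2 * E| ≤ M ^ 3 := by
    rw [abs_mul, abs_pow, pow_succ M]; gcongr
  have c3 : |A ^ 3| ≤ M ^ 3 := by rw [abs_pow]; gcongr
  -- a combination of `a` and `e` whose cofactors have small coefficients is small
  have bound (x u w : ℤ) (hx : 11 * x ^ 7 = g * (a * u + e * w)) (hu : |u| ≤ 96 * M ^ 3)
      (hw : |w| ≤ 43 * M ^ 3) : |x| ^ 7 ≤ 139 * M ^ 3 * H := by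
    have h1 : |a * u + e * w| ≤ 139 * M ^ 3 * H := by
      calc |a * u + e * w| ≤ |a| * |u| + |e| * |w| := by
            rw [← abs_mul, ← abs_mul]; exact abs_add_le _ _
        _ ≤ H * (96 * M ^ 3) + H * (43 * M ^ 3) := by gcongr
        _ = 139 * M ^ 3 * H := by ring
    have h2 : 11 * |x| ^ 7 ≤ 11 * (139 * M ^ 3 * H) := by
      calc 11 * |x| ^ 7 = |11 * x ^ 7| := by rw [abs_mul, abs_pow]; rfl
        _ = |g| * |a * u + e * w| := by rw [hx, abs_mul]
        _ ≤ 11 * (139 * M ^ 3 * H) := by gcongr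
    linarith
  rw [abs_le] at c0 c1 c2 c3
  have hEb := bound E _ _ hE7 (abs_le.2 ⟨by linarith, by linarith⟩)
    (abs_le.2 ⟨by linarith, by linarith⟩)
  have hAb := bound A _ _ hA7 (abs_le.2 ⟨by linarith, by linarith⟩)
    (abs_le.2 ⟨by linarith, by linarith⟩)
  have hMb : M ^ 7 ≤ 139 * M ^ 3 * H := by
    rcases max_cases |A| E with ⟨h, -⟩ | ⟨h, -⟩
    · rw [← hM] at h; rw [h] at hAb ⊢; exact hAb
    · rw [← hM] at h; rw [abs_of_pos hE] at hEb; rw [h] at hEb ⊢; exact hEb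
  refine le_of_mul_le_mul_left ?_ (pow_pos hM0 3)
  linarith

/-- A cubic polynomial of discriminant `-44`. -/
noncomputable def cubic : ℚ[X] := X ^ 3 - 2 * X ^ 2 + 2

theorem irreducible_cubic : Irreducible cubic := by
  have hd : (X ^ 3 - 2 * X ^ 2 + 2 : ℤ[X]).natDegree = 3 := by compute_degree!
  have hm : (X ^ 3 - 2 * X ^ 2 + 2 : ℤ[X]).Monic := by monicity!
  have hi : Irreducible (X ^ 3 - 2 * X ^ 2 + 2 : ℤ[X]) := by
    refine Polynomial.IsEisensteinAt.irreducible (𝓟 := Ideal.span {2}) ⟨?_, ?_, ?_⟩ ?_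
      hm.isPrimitive (by omega)
    · rw [hm.leadingCoeff, Ideal.mem_span_singleton]; norm_num
    · intro n hn
      rw [hd] at hn
      rw [Ideal.mem_span_singleton]
      interval_cases n <;> simp [coeff_ofNat_mul, coeff_X_pow]
    · rw [Ideal.span_singleton_pow, Ideal.mem_span_singleton]
      simp [coeff_ofNat_mul, coeff_X_pow]
    · rw [Ideal.span_singleton_prime (by norm_num)]; exact Int.prime_two
  have := (hm.irreducible_iff_irreducible_map_fraction_map (K := ℚ)).1 hi
  simpa [cubic] using this

/-- The cubic field of discriminant `-44`. -/
noncomputable abbrev CubicField : Type := AdjoinRoot cubic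

namespace CubicField

instance : Fact (Irreducible cubic) := ⟨irreducible_cubic⟩

/-- The generator, a root of `X ^ 3 - 2 * X ^ 2 + 2`. -/
noncomputable def v : CubicField := AdjoinRoot.root _

theorem v_cube : v ^ 3 = 2 * v ^ 2 - 2 := by
  have h : eval₂ (AdjoinRoot.of cubic) v (X ^ 3 - 2 * X ^ 2 + 2) = 0 := AdjoinRoot.eval₂_root cubic
  simp only [eval₂_add, eval₂_sub, eval₂_mul, eval₂_pow, eval₂_X, eval₂_ofNat] at h
  linear_combination h

/-- The power basis `1, v, v ^ 2`. -/
noncomputable def basis : Module.Basis (Fin 3) ℚ CubicField :=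
  (AdjoinRoot.powerBasis irreducible_cubic.ne_zero).basis.reindex
    (finCongr (by rw [AdjoinRoot.powerBasis_dim, cubic]; compute_degree!))

theorem basis_apply (i : Fin 3) : basis i = v ^ (i : ℕ) := by
  simp [basis, v]

instance : NumberField CubicField where
  to_charZero := algebraRat.charZero _
  to_finiteDimensional := Module.Basis.finiteDimensional_of_finite basis

theorem finrank_eq : Module.finrank ℚ CubicField = 3 := by
  simp [Module.finrank_eq_card_basis basis]

theorem repr_coords (p q r : ℚ) : ⇑(basis.repr (p + q * v + r * v ^ 2)) = ![p, q, r] := by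
  have h : (p + q * v + r * v ^ 2 : CubicField) = ∑ i, ![p, q, r] i • basis i := by
    simp [Fin.sum_univ_three, basis_apply, Algebra.smul_def]
  rw [h, basis.repr_sum_self]

theorem exists_coords (x : CubicField) : ∃ p q r : ℚ, x = p + q * v + r * v ^ 2 := by
  refine ⟨basis.repr x 0, basis.repr x 1, basis.repr x 2, ?_⟩
  conv_lhs => rw [← basis.sum_repr x]
  simp [Fin.sum_univ_three, basis_apply, Algebra.smul_def]

theorem leftMulMatrix_coords (p q r : ℚ) :
    Algebra.leftMulMatrix basis (p + q * v + r * v ^ 2) =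
      !![p, -2 * r, -2 * q - 4 * r; q, p, -2 * r; r, q + 2 * r, p + 2 * q + 4 * r] := by
  have h0 : (p + q * v + r * v ^ 2) * basis 0 = p + q * v + r * v ^ 2 := by simp [basis_apply]
  have h1 : (p + q * v + r * v ^ 2) * basis 1 =
      (-2 * r : ℚ) + p * v + (q + 2 * r : ℚ) * v ^ 2 := by
    simp [basis_apply]; linear_combination (r : CubicField) * v_cube
  have h2 : (p + q * v + r * v ^ 2) * basis 2 =
      (-2 * q - 4 * r : ℚ) + (-2 * r : ℚ) * v + (p + 2 * q + 4 * r : ℚ) * v ^ 2 := by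
    simp [basis_apply]; linear_combination (q + r * v + 2 * r : CubicField) * v_cube
  ext i j
  rw [Algebra.leftMulMatrix_eq_repr_mul]
  fin_cases j
  · simp only [Fin.zero_eta, h0, repr_coords]; fin_cases i <;> simp
  · simp only [Fin.mk_one, h1, repr_coords]; fin_cases i <;> simp
  · simp only [Fin.reduceFinMk, h2, repr_coords]; fin_cases i <;> simp

theorem norm_coords (p q r : ℚ) : Algebra.norm ℚ (p + q * v + r * v ^ 2 : CubicField) =
    !![p, -2 * r, -2 * q - 4 * r; q, p, -2 * r; r, q + 2 * r, p + 2 * q + 4 * r].det := by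
  rw [Algebra.norm_eq_matrix_det basis, leftMulMatrix_coords]

theorem trace_coords (p q r : ℚ) :
    Algebra.trace ℚ CubicField (p + q * v + r * v ^ 2) = 3 * p + 2 * q + 4 * r := by
  rw [Algebra.trace_eq_matrix_trace basis, leftMulMatrix_coords, Matrix.trace_fin_three]
  simp; ring

theorem discr_basis : Algebra.discr ℚ basis = -44 := by
  have h (i : ℕ) (p q r : ℚ) (hi : v ^ i = p + q * v + r * v ^ 2) :
      Algebra.trace ℚ CubicField (v ^ i) = 3 * p + 2 * q + 4 * r := by rw [hi, trace_coords]
  have h0 := h 0 1 0 0 (by simp)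
  have h1 := h 1 0 1 0 (by simp)
  have h2 := h 2 0 0 1 (by simp)
  have h3 := h 3 (-2) 0 2 (by push_cast; linear_combination v_cube)
  have h4 := h 4 (-4) (-2) 4 (by push_cast; linear_combination (v + 2) * v_cube)
  have hM : Algebra.traceMatrix ℚ basis = !![3, 2, 4; 2, 4, 2; 4, 2, 0] := by
    ext i j
    rw [Algebra.traceMatrix_apply, Algebra.traceForm_apply, basis_apply, basis_apply, ← pow_add]
    fin_cases i <;> fin_cases j <;>
      simp only [Fin.reduceFinMk, Fin.zero_eta, Fin.mk_one, Fin.isValue, Nat.reduceAdd,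
        h0, h1, h2, h3, h4] <;> simp <;> norm_num
  rw [Algebra.discr_def, hM, Matrix.det_fin_three]
  simp; norm_num

theorem isIntegral_v : IsIntegral ℤ v :=
  ⟨X ^ 3 - 2 * X ^ 2 + 2, by monicity!, by
    simp only [eval₂_add, eval₂_sub, eval₂_mul, eval₂_pow, eval₂_X, eval₂_ofNat]
    linear_combination v_cube⟩

/-- The generator as an algebraic integer. -/
noncomputable def ω : 𝓞 CubicField := ⟨v, isIntegral_v⟩

theorem exists_sq_mul_discr : ∃ n : ℤ, n ^ 2 * discr CubicField = -44 := by
  let e : Module.Free.ChooseBasisIndex ℤ (𝓞 CubicField) ≃ Fin 3 :=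
    Fintype.equivFinOfCardEq (by
      rw [← Module.finrank_eq_card_chooseBasisIndex, RingOfIntegers.rank, finrank_eq])
  let P : Matrix (Fin 3) (Fin 3) ℤ :=
    Matrix.of fun i j => (RingOfIntegers.basis CubicField).repr (ω ^ (j : ℕ)) (e.symm i)
  have hP : ((integralBasis CubicField).reindex e).toMatrix basis = P.map (Int.castRingHom ℚ) := by
    ext i j
    have hw : basis j = algebraMap (𝓞 CubicField) CubicField (ω ^ (j : ℕ)) := by
      rw [basis_apply, map_pow]; rfl
    simp only [Module.Basis.toMatrix_apply, Module.Basis.repr_reindex, hw,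
      Finsupp.mapDomain_equiv_apply, integralBasis_repr_apply, Matrix.map_apply, P, Matrix.of_apply]
    rfl
  refine ⟨P.det, ?_⟩
  have h := Algebra.discr_of_matrix_vecMul (A := ℚ) ((integralBasis CubicField).reindex e)
    (((integralBasis CubicField).reindex e).toMatrix basis)
  rw [Module.Basis.toMatrix_map_vecMul, discr_basis, Module.Basis.coe_reindex,
    Algebra.discr_reindex, ← coe_discr, hP, ← RingHom.mapMatrix_apply, ← RingHom.map_det] at h
  have h' : (P.det : ℚ) ^ 2 * discr CubicField = -44 := h.symm
  exact_mod_cast h'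

theorem nrComplexPlaces_eq : InfinitePlace.nrComplexPlaces CubicField = 1 := by
  obtain ⟨n, hn⟩ := exists_sq_mul_discr
  have hneg : discr CubicField < 0 := by nlinarith [sq_nonneg n]
  have hs := sign_discr CubicField
  rw [Int.sign_eq_neg_one_of_neg hneg] at hs
  have hr := InfinitePlace.card_add_two_mul_card_eq_rank CubicField
  rw [finrank_eq] at hr
  have : InfinitePlace.nrComplexPlaces CubicField ≤ 1 := by omega
  interval_cases h : InfinitePlace.nrComplexPlaces CubicField
  · norm_num at hs
  · rfl

instance : IsPrincipalIdealRing (𝓞 CubicField) := by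
  apply RingOfIntegers.isPrincipalIdealRing_of_abs_discr_lt
  obtain ⟨n, hn⟩ := exists_sq_mul_discr
  have hn0 : n ≠ 0 := by rintro rfl; norm_num at hn
  have hle : |discr CubicField| ≤ 44 := by
    have h1 : 1 ≤ n ^ 2 := Int.one_le_abs hn0 |>.trans (by nlinarith [sq_abs n, Int.one_le_abs hn0])
    rw [abs_le]
    constructor <;> nlinarith
  have hle' : ((|discr CubicField| : ℤ) : ℝ) ≤ 44 := by exact_mod_cast hle
  refine hle'.trans_lt ?_
  rw [finrank_eq, nrComplexPlaces_eq]
  norm_num [Nat.factorial]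
  nlinarith [Real.pi_gt_d2]

theorem units_rank : Units.rank CubicField = 1 := by
  have hr := InfinitePlace.card_add_two_mul_card_eq_rank CubicField
  rw [finrank_eq, nrComplexPlaces_eq] at hr
  rw [Units.rank, InfinitePlace.card_eq_nrRealPlaces_add_nrComplexPlaces, nrComplexPlaces_eq]
  omega

theorem coe_ω : (ω : CubicField) = v := rfl

theorem ω_cube : ω ^ 3 = 2 * ω ^ 2 - 2 := by
  apply RingOfIntegers.ext
  have h2 : algebraMap (𝓞 CubicField) CubicField 2 = 2 := map_ofNat _ 2
  simpa [coe_ω, h2] using v_cube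

theorem norm_ω_coords (p q r : ℤ) :
    Algebra.norm ℤ (p + q * ω + r * ω ^ 2) =
      !![p, -2 * r, -2 * q - 4 * r; q, p, -2 * r; r, q + 2 * r, p + 2 * q + 4 * r].det := by
  have h := norm_coords p q r
  have h' := Algebra.coe_norm_int (K := CubicField) (p + q * ω + r * ω ^ 2)
  have : ((p + q * ω + r * ω ^ 2 : 𝓞 CubicField) : CubicField) =
    (p : ℚ) + (q : ℚ) * v + (r : ℚ) * v ^ 2 := by simp [coe_ω]
  rw [this, h] at h'
  rw [← Int.cast_inj (α := ℚ), h', Matrix.det_fin_three, Matrix.det_fin_three]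
  simp

/-- The unit `1 - v`. -/
noncomputable def ε : (𝓞 CubicField)ˣ :=
  ⟨1 - ω, ω ^ 2 - ω - 1, by linear_combination -ω_cube, by linear_combination -ω_cube⟩

theorem norm_neg_eq (x : 𝓞 CubicField) : Algebra.norm ℤ (-x) = - Algebra.norm ℤ x := by
  have h := norm_ω_coords (-1) 0 0
  rw [← neg_one_mul, map_mul]
  simp [Matrix.det_fin_three] at h
  rw [h, neg_one_mul]

theorem norm_ε : Algebra.norm ℤ (ε : 𝓞 CubicField) = 1 := by
  have h := norm_ω_coords 1 (-1) 0
  simp [Matrix.det_fin_three] at h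
  rw [← h]
  congr 1

/-- A unit of norm one is a square up to a power of `ε`. -/
theorem unit_sq_or (hε : ¬ IsSquare ε) (u : (𝓞 CubicField)ˣ)
    (hu : Algebra.norm ℤ (u : 𝓞 CubicField) = 1) :
    ∃ t, u = t ^ 2 ∨ u = ε * t ^ 2 := by
  have hodd : Odd (Module.finrank ℚ CubicField) := by rw [finrank_eq]; decide
  have : Unique (Fin (Units.rank CubicField)) := by rw [units_rank]; infer_instance
  let φ := Units.fundSystem CubicField default
  have key (x : (𝓞 CubicField)ˣ) : ∃ k : ℤ, x = φ ^ k ∨ x = - φ ^ k := by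
    obtain ⟨⟨ζ, e⟩, h, -⟩ := Units.exist_unique_eq_mul_prod CubicField x
    refine ⟨e default, ?_⟩
    simp only [Fintype.prod_unique] at h
    rcases Units.torsion_eq_one_or_neg_one_of_odd_finrank hodd ζ with hζ | hζ
    · left; rw [h, hζ, one_mul]
    · right; rw [h, hζ, neg_one_mul]
  -- units of norm one that are squares up to sign are squares
  have sgn (x t : (𝓞 CubicField)ˣ) (hx : Algebra.norm ℤ (x : 𝓞 CubicField) = 1)
      (h : x = t ^ 2 ∨ x = - t ^ 2) : x = t ^ 2 := by
    refine h.resolve_right fun h => ?_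
    rw [h, Units.val_neg, norm_neg_eq, Units.val_pow_eq_pow_val, map_pow] at hx
    nlinarith [sq_nonneg (Algebra.norm ℤ (t : 𝓞 CubicField))]
  obtain ⟨k, hk⟩ := key u
  obtain ⟨l, hl⟩ := key ε
  have hlodd : Odd l := by
    rw [← Int.not_even_iff_odd]
    rintro ⟨m, rfl⟩
    refine hε ⟨φ ^ m, ?_⟩
    rw [← sq]
    apply sgn _ _ norm_ε
    rwa [sq, ← zpow_add]
  rcases Int.even_or_odd k with ⟨m, rfl⟩ | hkodd
  · refine ⟨φ ^ m, Or.inl (sgn _ _ hu ?_)⟩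
    rwa [sq, ← zpow_add]
  · obtain ⟨m, hm⟩ := hkodd.sub_odd hlodd
    refine ⟨φ ^ m, Or.inr ?_⟩
    have : u * ε⁻¹ = (φ ^ m) ^ 2 := by
      refine sgn _ _ ?_ ?_
      · have h1 := norm_ε
        have h2 : Algebra.norm ℤ ((ε⁻¹ : (𝓞 CubicField)ˣ) : 𝓞 CubicField) *
            Algebra.norm ℤ (ε : 𝓞 CubicField) = 1 := by
          rw [← map_mul, ← Units.val_mul, inv_mul_cancel, Units.val_one, map_one]
        rw [h1, mul_one] at h2
        rw [Units.val_mul, map_mul, hu, h2, one_mul]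
      · rw [sq, ← zpow_add, ← hm, zpow_sub]
        rcases hk with hk | hk <;> rcases hl with hl | hl <;> rw [hk, hl] <;> simp
    rw [← this, mul_comm, inv_mul_cancel_right]

theorem coords_injective {p q r p' q' r' : ℚ}
    (h : (p + q * v + r * v ^ 2 : CubicField) = p' + q' * v + r' * v ^ 2) :
    p = p' ∧ q = q' ∧ r = r' := by
  have h' := congrArg (fun x => ⇑(basis.repr x)) h
  simp only [repr_coords] at h'
  exact ⟨congrFun h' 0, congrFun h' 1, congrFun h' 2⟩

/-- `1 - v` times a square is never of the form `d ^ 2 - a * (2 * v - v ^ 2)` with `d ≠ 0`. -/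
theorem eq_zero_of_one_sub_v_mul_sq (η : CubicField) (d a : ℚ)
    (h : (1 - v) * η ^ 2 = d ^ 2 - a * (2 * v - v ^ 2)) : d = 0 := by
  obtain ⟨p, q, r, rfl⟩ := exists_coords η
  obtain ⟨h0, h1, h2⟩ := coords_injective
    (p := (p ^ 2 - 4 * q * r - 4 * r ^ 2) + 2 * (q ^ 2 + 2 * p * r + 4 * q * r + 4 * r ^ 2))
    (q := (2 * p * q - 2 * r ^ 2) - (p ^ 2 - 4 * q * r - 4 * r ^ 2))
    (r := -(2 * p * q - 2 * r ^ 2) - (q ^ 2 + 2 * p * r + 4 * q * r + 4 * r ^ 2))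
    (p' := d ^ 2) (q' := -2 * a) (r' := a) (by
      push_cast
      linear_combination h + (q ^ 2 + 2 * p * r + 2 * q * r * v + r ^ 2 * v ^ 2 + 2 * q * r
        + r ^ 2 * v + 2 * r ^ 2 : CubicField) * v_cube)
  refine rat_obstruction (p + q + 2 * r) q r d ?_ ?_
  · linear_combination -h1 - 2 * h2
  · linear_combination -h0

theorem not_isSquare_ε : ¬ IsSquare ε := by
  rintro ⟨t, ht⟩
  have h : (1 - v) * ((t⁻¹ : (𝓞 CubicField)ˣ) : CubicField) ^ 2 = 1 := by
    have h1 : ε * t⁻¹ ^ 2 = 1 := by rw [ht]; group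
    have h2 := congrArg (fun u : (𝓞 CubicField)ˣ => ((u : 𝓞 CubicField) : CubicField)) h1
    simpa [ε, coe_ω] using h2
  have := eq_zero_of_one_sub_v_mul_sq _ 1 0 (by rw [h]; simp)
  norm_num at this

/-- The `2`-descent: `d ^ 2 - a * (2 * v - v ^ 2)` is a square once its norm is. -/
theorem isSquare_of_norm {a d b : ℤ} (hd : 0 < d) (hc : IsCoprime a (d ^ 2))
    (h : b ^ 2 = 4 * a ^ 3 - 4 * a ^ 2 * d ^ 2 + d ^ 6) :
    ∃ η : CubicField, (d ^ 2 - a * (2 * v - v ^ 2) : CubicField) = η ^ 2 := by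
  set ξ : 𝓞 CubicField := d ^ 2 - a * (2 * ω - ω ^ 2) with hξ
  have hN : Algebra.norm ℤ ξ = b ^ 2 := by
    have := norm_ω_coords (d ^ 2) (-2 * a) a
    rw [h, hξ]
    convert this using 1
    · congr 1; push_cast; ring
    · rw [Matrix.det_fin_three]; simp; ring
  have hcoe : (ξ : CubicField) = d ^ 2 - a * (2 * v - v ^ 2) := by
    have h2 : algebraMap (𝓞 CubicField) CubicField 2 = 2 := map_ofNat _ 2
    simp [hξ, coe_ω, h2]
  have hξ0 : ξ ≠ 0 := by
    intro h0
    rw [h0] at hcoe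
    have hz : ((0 : 𝓞 CubicField) : CubicField) = 0 := map_zero (algebraMap _ _)
    obtain ⟨h1, -, -⟩ := coords_injective (p := d ^ 2) (q := -2 * a) (r := a)
      (p' := 0) (q' := 0) (r' := 0) (by
        push_cast; linear_combination hz - hcoe)
    have : (d : ℚ) ≠ 0 := by exact_mod_cast hd.ne'
    exact this (pow_eq_zero_iff two_ne_zero |>.1 h1)
  have hmul : ξ * (d ^ 4 + a * d ^ 2 * (2 * ω - ω ^ 2) + a ^ 2 * (2 * ω - ω ^ 2) ^ 2 - 4 * a ^ 2) =
      (b : 𝓞 CubicField) ^ 2 := by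
    have hb : (b : 𝓞 CubicField) ^ 2 = 4 * a ^ 3 - 4 * a ^ 2 * d ^ 2 + d ^ 6 := by
      exact_mod_cast congrArg (Int.cast : ℤ → 𝓞 CubicField) h
    rw [hb, hξ]
    linear_combination (a : 𝓞 CubicField) ^ 3 * (ω ^ 3 - 4 * ω ^ 2 + 4 * ω - 2) * ω_cube
  obtain ⟨s, t, hs, hst, hsd⟩ := exists_squarefree_dvd_of_mul_eq_sq hξ0 hmul
  have hsa : IsCoprime s (a : 𝓞 CubicField) := by
    obtain ⟨m, n, hmn⟩ := hc
    have hmn' : (m * a + n * d ^ 2 : 𝓞 CubicField) = 1 := by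
      exact_mod_cast congrArg (Int.cast : ℤ → 𝓞 CubicField) hmn
    refine ⟨n * t ^ 2, m + n * (2 * ω - ω ^ 2), ?_⟩
    linear_combination hmn' - n * hst
  have hs1 : s ∣ (3 * (2 * ω - ω ^ 2) ^ 2 - 4) := by
    refine (hsa.pow_right (n := 2)).dvd_of_dvd_mul_left ?_
    have h1 : s ∣ ξ := ⟨_, hst⟩
    have h2 := dvd_sub hsd (h1.mul_right (d ^ 2 + 2 * a * (2 * ω - ω ^ 2)))
    convert h2 using 1
    rw [hξ]; ring
  have hs2 : s ∣ ω * (3 - ω ^ 2) := by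
    rw [← hs.dvd_pow_iff_dvd (n := 4) (by norm_num)]
    refine hs1.trans ⟨(ω ^ 2 - 1) ^ 2 * (3 - ω ^ 2) ^ 3, ?_⟩
    have h1 : (2 * ω - ω ^ 2) * (ω ^ 2 - 1) = ω ^ 2 := by linear_combination (-ω) * ω_cube
    have h2 : ω * (2 * ω - ω ^ 2) = 2 := by linear_combination -ω_cube
    calc (ω * (3 - ω ^ 2)) ^ 4
        = ((2 * ω - ω ^ 2) * (ω ^ 2 - 1)) ^ 2 * (3 - ω ^ 2) ^ 4 := by rw [h1]; ring
      _ = (3 * (2 * ω - ω ^ 2) ^ 2 - (ω * (2 * ω - ω ^ 2)) ^ 2) *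
            ((ω ^ 2 - 1) ^ 2 * (3 - ω ^ 2) ^ 3) := by ring
      _ = _ := by rw [h2]; norm_num
  have hs3 : Algebra.norm ℤ s ∣ 22 := by
    have h1 := map_dvd (Algebra.norm ℤ) hs2
    have h2 := norm_ω_coords 2 3 (-2)
    have h3 : ω * (3 - ω ^ 2) = (2 : ℤ) + (3 : ℤ) * ω + (-2 : ℤ) * ω ^ 2 := by
      push_cast; linear_combination -ω_cube
    rw [h3, h2, Matrix.det_fin_three] at h1
    simpa using h1
  have hs4 : Algebra.norm ℤ s = 1 := by
    have h1 : Algebra.norm ℤ s * Algebra.norm ℤ t ^ 2 = b ^ 2 := by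
      rw [← map_pow, ← map_mul, ← hst, hN]
    have hb0 : Algebra.norm ℤ t ≠ 0 := by
      rw [Algebra.norm_ne_zero_iff]; rintro rfl; simp [hξ0] at hst
    obtain ⟨k, rfl⟩ : Algebra.norm ℤ t ∣ b :=
      (Int.pow_dvd_pow_iff two_ne_zero).1 ⟨_, by rw [← h1, mul_comm]⟩
    have hk : Algebra.norm ℤ s = k ^ 2 :=
      mul_right_cancel₀ (pow_ne_zero 2 hb0) (by rw [h1]; ring)
    rw [hk] at hs3 ⊢
    have hk22 := Int.le_of_dvd (by norm_num) hs3
    have : k ≤ 4 := by nlinarith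
    have : -4 ≤ k := by nlinarith
    interval_cases k <;> revert hs3 <;> decide
  obtain ⟨u, rfl⟩ : IsUnit s := by
    rw [NumberField.isUnit_iff_norm, RingOfIntegers.coe_norm, ← Algebra.coe_norm_int, hs4]
    simp
  obtain ⟨k, rfl | rfl⟩ := unit_sq_or not_isSquare_ε u hs4
  · refine ⟨(k : 𝓞 CubicField) * t, ?_⟩
    rw [← hcoe, hst]; simp; ring
  · have := eq_zero_of_one_sub_v_mul_sq ((k : 𝓞 CubicField) * t) d a (by
      push_cast
      rw [← hcoe, hst]; simp [ε, coe_ω]; ring)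
    exact absurd (by exact_mod_cast this) hd.ne'

/-- Every rational point of `y ^ 2 = 4 x ^ 3 - 4 x ^ 2 + 1` is the double of a rational point. -/
theorem exists_half {x y : ℚ} (h : y ^ 2 = 4 * x ^ 3 - 4 * x ^ 2 + 1) :
    ∃ X Y : ℚ, Y ^ 2 = 4 * X ^ 3 - 4 * X ^ 2 + 1 ∧
      x * (4 * X ^ 3 - 4 * X ^ 2 + 1) = X ^ 4 - 2 * X + 1 := by
  obtain ⟨d, b, hd, hden, hb⟩ := exists_integral_coords h
  obtain ⟨η, hη⟩ := isSquare_of_norm hd (hden ▸ Rat.isCoprime_num_den x) hb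
  have hdK : (d : CubicField) ≠ 0 := by exact_mod_cast hd.ne'
  have hx : (d : ℚ) ^ 2 * x = x.num := by
    have h1 : ((x.den : ℤ) : ℚ) = d ^ 2 := by exact_mod_cast congrArg (Int.cast : ℤ → ℚ) hden
    have h2 := Rat.den_mul_eq_num x
    rw [← h1]; exact_mod_cast h2
  have hxK : (d : CubicField) ^ 2 * x = x.num := by
    exact_mod_cast congrArg (Rat.cast : ℚ → CubicField) hx
  -- `v * (1 - v)` has inverse `i`
  obtain ⟨i, hi⟩ : ∃ i : CubicField, v * (1 - v) * i = 1 :=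
    ⟨(v ^ 2 - v - 1) * (v * (2 - v) / 2), by
      linear_combination (-1 / 2 * (1 - v) * (v ^ 2 - v - 1) - 1) * v_cube⟩
  obtain ⟨p, q, r, hζ⟩ := exists_coords (i * η / d)
  have hsq : (p + q * v + r * v ^ 2 : CubicField) ^ 2 = x - v / 2 := by
    have hw : (v * (1 - v)) ^ 2 * (x - v / 2) = 1 - x * (2 * v - v ^ 2) := by
      linear_combination (x * v - v ^ 2 / 2 - 1 / 2 : CubicField) * v_cube
    rw [← hζ, div_pow, mul_pow, ← hη, div_eq_iff (pow_ne_zero 2 hdK), ← hxK]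
    linear_combination (-i ^ 2 * (d : CubicField) ^ 2) * hw + (d : CubicField) ^ 2 * (x - v / 2) *
      (v * (1 - v) * i + 1) * hi
  obtain ⟨h0, h1, h2⟩ := coords_injective
    (p := p ^ 2 - 4 * q * r - 4 * r ^ 2) (q := 2 * p * q - 2 * r ^ 2)
    (r := q ^ 2 + 2 * p * r + 4 * q * r + 4 * r ^ 2)
    (p' := x) (q' := -1 / 2) (r' := 0) (by
      push_cast
      linear_combination hsq - (2 * q * r + r ^ 2 * v + 2 * r ^ 2 : CubicField) * v_cube)
  have hr : r ≠ 0 := by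
    rintro rfl
    have hq : q = 0 := by simpa using h2
    subst hq
    norm_num at h1
  obtain ⟨X, hX⟩ : ∃ X : ℚ, q = 2 * r * (X - 1) := ⟨1 + q / (2 * r), by field_simp; ring⟩
  subst hX
  have hp : p = -2 * X ^ 2 * r := by
    apply mul_left_cancel₀ hr
    linear_combination h2 / 2
  subst hp
  have hr2 : 4 * r ^ 2 * (4 * X ^ 3 - 4 * X ^ 2 + 1) = 1 := by linear_combination -2 * h1
  refine ⟨X, 1 / (2 * r), ?_, ?_⟩
  · field_simp; linear_combination -hr2
  · linear_combination (-4 * X ^ 3 + 4 * X ^ 2 - 1) * h0 + (X ^ 4 - 2 * X + 1) * hr2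

end CubicField

/-- The integral coordinates of the points of small height. -/
theorem eq_of_abs_le_five {a d b : ℤ} (hd : 0 < d) (hd2 : d ≤ 2) (h1 : -5 ≤ a) (h2 : a ≤ 5)
    (hc : IsCoprime a (d ^ 2)) (h : b ^ 2 = 4 * a ^ 3 - 4 * a ^ 2 * d ^ 2 + d ^ 6) :
    d = 1 ∧ (a = 0 ∨ a = 1) := by
  have hb : b.natAbs ^ 2 < 21 ^ 2 := by
    zify
    rw [sq_abs, h]
    interval_cases d <;> interval_cases a <;> norm_num
  have hb' := lt_of_pow_lt_pow_left₀ 2 (by norm_num) hb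
  rw [← Int.natAbs_sq] at h
  rw [Int.isCoprime_iff_gcd_eq_one] at hc
  generalize b.natAbs = n at *
  clear hb
  interval_cases d <;> interval_cases a <;> revert hc <;> revert n <;> decide

/-- The affine rational points of the elliptic curve `y ^ 2 = 4 x ^ 3 - 4 x ^ 2 + 1` have
abscissa `0` or `1`. -/
theorem eq_zero_or_one_of_sq_eq {x y : ℚ} (h : y ^ 2 = 4 * x ^ 3 - 4 * x ^ 2 + 1) :
    x = 0 ∨ x = 1 := by
  induction hn : (max |x.num| (x.den : ℤ)).toNat using Nat.strong_induction_on
    generalizing x y with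
  | _ n ih =>
    obtain ⟨X, Y, hXY, hdup⟩ := CubicField.exists_half h
    have hx0 : (0 : ℤ) < x.den := by exact_mod_cast x.den_pos
    have hX0 : (0 : ℤ) < X.den := by exact_mod_cast X.den_pos
    have hM0 : 0 < max |X.num| (X.den : ℤ) := lt_max_of_lt_right hX0
    by_cases hlt : max |X.num| (X.den : ℤ) < max |x.num| (x.den : ℤ)
    · rcases ih _ (by omega) hXY rfl with rfl | rfl
      · right; linarith
      · left; linarith
    · push Not at hlt
      have hb := height_bound (a := x.num) (e := x.den) (A := X.num) (E := X.den)
        (Rat.isCoprime_num_den x) hx0 (Rat.isCoprime_num_den X) hX0 (by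
          have hxq : (x.den : ℚ) ≠ 0 := by exact_mod_cast x.den_ne_zero
          have hXq : (X.den : ℚ) ≠ 0 := by exact_mod_cast X.den_ne_zero
          rw [← x.num_div_den, ← X.num_div_den] at hdup
          field_simp at hdup
          qify
          linear_combination hdup)
      have hM : max |X.num| (X.den : ℤ) ≤ 5 := by
        by_contra! hcon
        have : 6 ^ 3 ≤ max |X.num| (X.den : ℤ) ^ 3 := by gcongr; omega
        nlinarith
      have hle := max_le_iff.1 (hlt.trans hM)
      obtain ⟨d, b, hd, hden, hb⟩ := exists_integral_coords h
      have hc := Rat.isCoprime_num_den x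
      have hxe := x.num_div_den
      have hdq : (x.den : ℚ) = d ^ 2 := by exact_mod_cast congrArg (Int.cast : ℤ → ℚ) hden
      rw [hdq] at hxe
      rw [hden] at hc hle
      obtain ⟨h1, h2⟩ := abs_le.1 hle.1
      have hd2 : d ≤ 2 := by nlinarith [hle.2]
      rcases eq_of_abs_le_five hd hd2 h1 h2 hc hb with ⟨rfl, h0 | h0⟩
      · left; rw [← hxe, h0]; norm_num
      · right; rw [← hxe, h0]; norm_num

theorem rational_points_X0_3_4 (T U : ℚ) :
    -(T ^ 2 + 2 * T + 8) * U ^ 2 = (U ^ 2 + U + 4) * (U - 4) ↔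
      ((T, U) = (0, -4) ∨ (T, U) = (-2, -4)) := by
  simp only [Prod.mk.injEq]
  constructor
  · intro h
    have hU : (-U / 4) = 0 ∨ (-U / 4) = 1 :=
      eq_zero_or_one_of_sq_eq (y := (T + 1) * U / 4) (by linear_combination -h / 16)
    rcases hU with hU | hU
    · obtain rfl : U = 0 := by linarith
      norm_num at h
    · obtain rfl : U = -4 := by linarith
      have hT : T * (T + 2) = 0 := by linear_combination -h / 16
      rcases mul_eq_zero.1 hT with hT | hT
      · exact Or.inl ⟨hT, rfl⟩
      · exact Or.inr ⟨by linarith, rfl⟩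
  · rintro (⟨rfl, rfl⟩ | ⟨rfl, rfl⟩) <;> norm_num
end
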